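/- arXiv:2508.21214 — 2 statements merged into one kernel-verified Lean document; each statement's English description precedes it below -/
import Mathlib

section
/- There are constants C₀, C > 0, depending only on the dimension n, such that for every cube Q ⊂ ℝⁿ of side length ℓ(Q) and every function u harmonic on a neighborhood of the ball of radius 20n·ℓ(Q) around Q, the maximal doubling index satisfies N(Q) ≤ C₀ + C · sup_{x ∈ Q} log( sup_{B(x, 10n·ℓ(Q))} |∇u| / sup_{B(x, ℓ(Q))} |∇u| ). -/
open MeasureTheory Metric Set ENNReal Matrix RealInnerProductSpace

/-- `sup` of `|∇u|` over a set. -/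
noncomputable def supGrad {n : ℕ} (u : EuclideanSpace ℝ (Fin n) → ℝ)
    (s : Set (EuclideanSpace ℝ (Fin n))) : ℝ :=
  sSup ((fun x => ‖fderiv ℝ u x‖) '' s)

/-- `u` is harmonic on `U`: smooth on `U` and its Laplacian vanishes on `U`. -/
def IsHarmonicOn {n : ℕ} (u : EuclideanSpace ℝ (Fin n) → ℝ)
    (U : Set (EuclideanSpace ℝ (Fin n))) : Prop :=
  ContDiffOn ℝ (⊤ : ℕ∞) u U ∧
    ∀ x ∈ U, ∑ i : Fin n,
      fderiv ℝ (fun y => fderiv ℝ u y (EuclideanSpace.single i 1)) x (EuclideanSpace.single i 1) = 0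

/-- normalized doubling index of the gradient on `B(x,r)`:
`N(x,r) = log ( sup_{B(x,2r)} |∇u| / sup_{B(x,r)} |∇u| )`. -/
noncomputable def doublingIndex {n : ℕ} (u : EuclideanSpace ℝ (Fin n) → ℝ)
    (x : EuclideanSpace ℝ (Fin n)) (r : ℝ) : ℝ :=
  Real.log (supGrad u (ball x (2 * r)) / supGrad u (ball x r))

/-- the closed axis-parallel cube with center `c` and side length `ℓ` -/
def cube {n : ℕ} (c : EuclideanSpace ℝ (Fin n)) (ℓ : ℝ) : Set (EuclideanSpace ℝ (Fin n)) :=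
  {x | ∀ i, |x i - c i| ≤ ℓ / 2}

/-- maximal normalized doubling index of the cube of center `c` and side `ℓ`:
`N(Q) = sup_{x ∈ Q, 0 < r ≤ ℓ(Q)} log ( sup_{B(x,10nr)} |∇u| / sup_{B(x,r)} |∇u| )`. -/
noncomputable def cubeDoublingIndex {n : ℕ} (u : EuclideanSpace ℝ (Fin n) → ℝ)
    (c : EuclideanSpace ℝ (Fin n)) (ℓ : ℝ) : ℝ :=
  sSup {t | ∃ x ∈ cube c ℓ, ∃ r : ℝ, 0 < r ∧ r ≤ ℓ ∧
    t = Real.log (supGrad u (ball x (10 * n * r)) / supGrad u (ball x r))}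

/-- `s`-dimensional Hausdorff content -/
noncomputable def hausdorffContent {n : ℕ} (s : ℝ) (E : Set (EuclideanSpace ℝ (Fin n))) : ℝ≥0∞ :=
  ⨅ (U : ℕ → Set (EuclideanSpace ℝ (Fin n))) (_ : E ⊆ ⋃ i, U i), ∑' i, EMetric.diam (U i) ^ s

/-- Riesz `s`-energy of a measure: `I_s(μ) = ∬ |x-y|^{-s} dμ(x) dμ(y)`. -/
noncomputable def rieszEnergy {n : ℕ} (s : ℝ) (μ : Measure (EuclideanSpace ℝ (Fin n))) : ℝ≥0∞ :=
  ∫⁻ x, ∫⁻ y, edist x y ^ (-s) ∂μ ∂μ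

/-- Riesz `s`-capacity of a set: the sup of `I_s(μ)⁻¹` over probability measures compactly
supported in `E`. -/
noncomputable def rieszCapacity {n : ℕ} (s : ℝ) (E : Set (EuclideanSpace ℝ (Fin n))) : ℝ≥0∞ :=
  ⨆ (μ : Measure (EuclideanSpace ℝ (Fin n)))
    (_ : μ E = 1 ∧ ∃ K, IsCompact K ∧ K ⊆ E ∧ μ Kᶜ = 0), (rieszEnergy s μ)⁻¹

/-- a function `Fin n → ℝ` regarded as a point of `EuclideanSpace ℝ (Fin n)` -/
noncomputable def vec {n : ℕ} (f : Fin n → ℝ) : EuclideanSpace ℝ (Fin n) :=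
  (EuclideanSpace.equiv (Fin n) ℝ).symm f

/-- center of the subcube indexed by `k` when the cube of center `c` and side `ℓ` is divided
into `M^n` congruent subcubes -/
noncomputable def subCenter {n : ℕ} (c : EuclideanSpace ℝ (Fin n)) (ℓ : ℝ) (M : ℕ)
    (k : Fin n → Fin M) : EuclideanSpace ℝ (Fin n) :=
  vec (fun i => c i + (((k i : ℝ) + 1 / 2) / M - 1 / 2) * ℓ)

/-- the last coordinate index of `Fin n` -/
def lastIdx (n : ℕ) (hn : 0 < n) : Fin n := ⟨n - 1, Nat.sub_lt hn Nat.one_pos⟩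

/-- the hyperplane `{xₙ = 0}` -/
def lastHyperplane (n : ℕ) (hn : 0 < n) : Set (EuclideanSpace ℝ (Fin n)) :=
  {x | x (lastIdx n hn) = 0}


open scoped ContDiff

namespace CMD

variable {n : ℕ}


noncomputable def bas (i : Fin n) : EuclideanSpace ℝ (Fin n) := EuclideanSpace.single i 1

noncomputable def lap (f : EuclideanSpace ℝ (Fin n) → ℝ) (x : EuclideanSpace ℝ (Fin n)) : ℝ :=
  ∑ i : Fin n, fderiv ℝ (fun y => fderiv ℝ f y (bas i)) x (bas i)

noncomputable def cutW (y : EuclideanSpace ℝ (Fin n)) : ℝ := (max (1 - ‖y‖ ^ 2) 0) ^ 3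

noncomputable def wt (y : EuclideanSpace ℝ (Fin n)) : ℝ := 6 * (max (1 - ‖y‖ ^ 2) 0) ^ 2

lemma hasDerivAt_max_cube (t : ℝ) : HasDerivAt (fun t : ℝ => (max t 0) ^ 3) (3 * (max t 0) ^ 2) t := by
  rcases lt_trichotomy t 0 with h | h | h
  · have : (fun t : ℝ => (max t 0) ^ 3) =ᶠ[nhds t] fun _ => 0 := by
      filter_upwards [Iio_mem_nhds h] with s hs
      rw [max_eq_right (le_of_lt hs)]; norm_num
    rw [max_eq_right h.le]
    simpa using (hasDerivAt_const t (0:ℝ)).congr_of_eventuallyEq this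
  · subst h
    rw [hasDerivAt_iff_isLittleO_nhds_zero]
    have h1 : (fun h : ℝ => h ^ 2) =o[nhds 0] fun h : ℝ => h := by
      simpa using Asymptotics.isLittleO_pow_id (𝕜 := ℝ) (n := 2) (by norm_num)
    refine Asymptotics.IsBigO.trans_isLittleO ?_ h1
    refine Asymptotics.IsBigO.of_bound 1 ?_
    filter_upwards [Metric.ball_mem_nhds (0:ℝ) one_pos] with s hs
    rw [mem_ball_zero_iff, Real.norm_eq_abs] at hs
    have h2 : |max s 0| ≤ |s| := by
      rcases le_total s 0 with h | h
      · simp [max_eq_right h]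
      · simp [max_eq_left h]
    simp only [zero_add, max_self, smul_eq_mul, Real.norm_eq_abs]
    have : |max s 0 ^ 3 - 0 ^ 3 - s * (3 * 0 ^ 2)| = |max s 0| ^ 3 := by
      rw [← abs_pow]; congr 1; ring
    rw [this, abs_pow, one_mul]
    calc |max s 0| ^ 3 ≤ |s| ^ 3 := by gcongr
      _ = |s| ^ 2 * |s| := by ring
      _ ≤ |s| ^ 2 * 1 := by gcongr
      _ = _ := by ring
  · have : (fun t : ℝ => (max t 0) ^ 3) =ᶠ[nhds t] fun t => t ^ 3 := by
      filter_upwards [Ioi_mem_nhds h] with s hs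
      rw [max_eq_left (le_of_lt hs)]
    rw [max_eq_left h.le]
    simpa using (hasDerivAt_pow 3 t).congr_of_eventuallyEq this

lemma hasFDerivAt_cutW (y : EuclideanSpace ℝ (Fin n)) :
    HasFDerivAt cutW (-(wt y) • innerSL ℝ y) y := by
  have h1 : HasFDerivAt (fun y : EuclideanSpace ℝ (Fin n) => 1 - ‖y‖ ^ 2) (-(2 • innerSL ℝ y)) y := by
    simpa using (hasStrictFDerivAt_norm_sq y).hasFDerivAt.const_sub 1
  have h2 := (hasDerivAt_max_cube (1 - ‖y‖ ^ 2)).comp_hasFDerivAt y h1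
  have he : (3 * max (1 - ‖y‖ ^ 2) 0 ^ 2) • -(2 • innerSL ℝ y) = -(wt y) • innerSL ℝ y := by
    ext v
    simp [wt]
    ring
  rw [he] at h2
  exact h2

lemma continuous_wt : Continuous (wt : EuclideanSpace ℝ (Fin n) → ℝ) := by
  unfold wt; fun_prop

lemma continuous_cutW : Continuous (cutW : EuclideanSpace ℝ (Fin n) → ℝ) := by
  unfold cutW; fun_prop

lemma wt_nonneg (y : EuclideanSpace ℝ (Fin n)) : 0 ≤ wt y := by unfold wt; positivity
lemma cutW_nonneg (y : EuclideanSpace ℝ (Fin n)) : 0 ≤ cutW y := by unfold cutW; positivity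
lemma wt_le (y : EuclideanSpace ℝ (Fin n)) : wt y ≤ 6 := by
  unfold wt
  have : max (1 - ‖y‖ ^ 2) 0 ≤ 1 := max_le (by nlinarith [norm_nonneg y]) (by norm_num)
  have h0 : 0 ≤ max (1 - ‖y‖ ^ 2) 0 := le_max_right _ _
  nlinarith
lemma wt_zero {y : EuclideanSpace ℝ (Fin n)} (h : 1 ≤ ‖y‖) : wt y = 0 := by
  unfold wt
  rw [max_eq_right (by nlinarith)]; norm_num
lemma cutW_zero {y : EuclideanSpace ℝ (Fin n)} (h : 1 ≤ ‖y‖) : cutW y = 0 := by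
  unfold cutW
  rw [max_eq_right (by nlinarith)]; norm_num
lemma one_le_wt {y : EuclideanSpace ℝ (Fin n)} (h : ‖y‖ ≤ 3 / 4) : 1 ≤ wt y := by
  unfold wt
  have h1 : 7 / 16 ≤ max (1 - ‖y‖ ^ 2) 0 := le_max_of_le_left (by nlinarith [norm_nonneg y])
  nlinarith

lemma hcs_wt : HasCompactSupport (wt : EuclideanSpace ℝ (Fin n) → ℝ) := by
  refine HasCompactSupport.intro (isCompact_closedBall 0 1) ?_
  intro x hx
  rw [mem_closedBall_zero_iff, not_le] at hx
  exact wt_zero hx.le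
lemma hcs_cutW : HasCompactSupport (cutW : EuclideanSpace ℝ (Fin n) → ℝ) := by
  refine HasCompactSupport.intro (isCompact_closedBall 0 1) ?_
  intro x hx
  rw [mem_closedBall_zero_iff, not_le] at hx
  exact cutW_zero hx.le

lemma integ_wt {f : EuclideanSpace ℝ (Fin n) → ℝ} (hf : Continuous f) :
    Integrable (fun y => f y * wt y) :=
  (hf.mul continuous_wt).integrable_of_hasCompactSupport hcs_wt.mul_left
lemma integ_cutW {f : EuclideanSpace ℝ (Fin n) → ℝ} (hf : Continuous f) :
    Integrable (fun y => f y * cutW y) :=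
  (hf.mul continuous_cutW).integrable_of_hasCompactSupport hcs_cutW.mul_left

lemma wt_int_pos : 0 < ∫ y : EuclideanSpace ℝ (Fin n), wt y := by
  refine continuous_wt.integral_pos_of_hasCompactSupport_nonneg_nonzero hcs_wt wt_nonneg (x := 0) ?_
  have := one_le_wt (n := n) (y := 0) (by norm_num)
  linarith

lemma smooth_D {f : EuclideanSpace ℝ (Fin n) → ℝ} (hf : ContDiff ℝ ∞ f)
    (a : EuclideanSpace ℝ (Fin n)) : ContDiff ℝ ∞ (fun y => fderiv ℝ f y a) :=
  (hf.fderiv_right (m := ∞) (by simp)).clm_apply contDiff_const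

lemma sum_bas (y : EuclideanSpace ℝ (Fin n)) : ∑ i, (y i) • bas i = y := by
  ext j
  simp [bas, Finset.sum_apply, Pi.single_apply]

lemma fderiv_self_expand (L : (EuclideanSpace ℝ (Fin n)) →L[ℝ] ℝ) (y : EuclideanSpace ℝ (Fin n)) :
    L y = ∑ i, y i * L (bas i) := by
  conv_lhs => rw [← sum_bas y]
  simp

lemma ibp {f g : EuclideanSpace ℝ (Fin n) → ℝ} (hf : ContDiff ℝ ∞ f) (hg : ContDiff ℝ ∞ g)
    (hl : ∀ y ∈ ball (0 : EuclideanSpace ℝ (Fin n)) 1, lap f y = 0) :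
    ∫ y, (fderiv ℝ f y y * g y) * wt y =
      ∫ y, (∑ i, fderiv ℝ f y (bas i) * fderiv ℝ g y (bas i)) * cutW y := by
  have hd : Differentiable ℝ (cutW : EuclideanSpace ℝ (Fin n) → ℝ) :=
    fun y => (hasFDerivAt_cutW y).differentiableAt
  have hfd : ∀ y v, fderiv ℝ (cutW : EuclideanSpace ℝ (Fin n) → ℝ) y v = - wt y * inner ℝ y v := by
    intro y v; rw [(hasFDerivAt_cutW y).fderiv]; simp
  have hP : ∀ i : Fin n, ContDiff ℝ ∞ (fun y => fderiv ℝ f y (bas i) * g y) :=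
    fun i => (smooth_D hf _).mul hg
  have hin : ∀ (y : EuclideanSpace ℝ (Fin n)) (i : Fin n), inner ℝ y (bas i) = y i := by
    intro y i; simp [bas, EuclideanSpace.inner_single_right]
  have key : ∀ i : Fin n,
      ∫ y, (fderiv ℝ f y (bas i) * g y * y i) * wt y =
      ∫ y, (fderiv ℝ (fun y => fderiv ℝ f y (bas i) * g y) y (bas i)) * cutW y := by
    intro i
    have := integral_mul_fderiv_eq_neg_fderiv_mul_of_integrable (μ := volume)
      (f := fun y => fderiv ℝ f y (bas i) * g y) (g := cutW) (v := bas i)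
      (integ_cutW (smooth_D (hP i) _).continuous)
      (by
        have h1 : Integrable (fun y => (-(fderiv ℝ f y (bas i) * g y * y i)) * wt y) :=
          integ_wt (by have := (hP i).continuous; fun_prop)
        refine h1.congr (Filter.Eventually.of_forall fun y => ?_)
        simp only [hfd, hin]; ring)
      (integ_cutW (hP i).continuous)
      (fun x _ => ((hP i).differentiable (by simp)) x) (fun x _ => hd x)
    have h2 : ∀ y, fderiv ℝ f y (bas i) * g y * fderiv ℝ cutW y (bas i)
        = -((fderiv ℝ f y (bas i) * g y * y i) * wt y) := by
      intro y; simp only [hfd, hin]; ring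
    simp only [h2, integral_neg] at this
    linarith
  calc ∫ y, (fderiv ℝ f y y * g y) * wt y
      = ∫ y, ∑ i, (fderiv ℝ f y (bas i) * g y * y i) * wt y := by
        congr 1; ext y
        rw [fderiv_self_expand (fderiv ℝ f y) y, Finset.sum_mul, Finset.sum_mul]
        refine Finset.sum_congr rfl fun i _ => by ring
    _ = ∑ i, ∫ y, (fderiv ℝ f y (bas i) * g y * y i) * wt y := by
        rw [integral_finsetSum]
        intro i _
        exact integ_wt (by have := (hP i).continuous; fun_prop)
    _ = ∑ i, ∫ y, (fderiv ℝ (fun y => fderiv ℝ f y (bas i) * g y) y (bas i)) * cutW y := by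
        simp only [key]
    _ = ∫ y, ∑ i, (fderiv ℝ (fun y => fderiv ℝ f y (bas i) * g y) y (bas i)) * cutW y := by
        rw [integral_finsetSum]
        intro i _
        exact integ_cutW (smooth_D (hP i) _).continuous
    _ = _ := by
        congr 1; ext y
        rw [← Finset.sum_mul]
        by_cases hy : 1 ≤ ‖y‖
        · rw [cutW_zero hy]; simp
        · have h0 := hl y (by rw [mem_ball_zero_iff]; exact not_le.1 hy)
          congr 1
          have h3 : ∀ i : Fin n, fderiv ℝ (fun y => fderiv ℝ f y (bas i) * g y) y (bas i)
              = fderiv ℝ f y (bas i) * fderiv ℝ g y (bas i)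
                + g y * fderiv ℝ (fun y => fderiv ℝ f y (bas i)) y (bas i) := by
            intro i
            rw [fderiv_fun_mul ((smooth_D hf _).differentiable (by simp) y)
              (hg.differentiable (by simp) y)]
            simp
          simp only [h3, Finset.sum_add_distrib, ← Finset.mul_sum]
          unfold lap at h0
          rw [h0]; simp

lemma hasDerivAt_int {G G' : ℝ → EuclideanSpace ℝ (Fin n) → ℝ}
    (hG : Continuous (fun p : ℝ × EuclideanSpace ℝ (Fin n) => G p.1 p.2))
    (hG' : Continuous (fun p : ℝ × EuclideanSpace ℝ (Fin n) => G' p.1 p.2))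
    (hd : ∀ t y, HasDerivAt (fun t => G t y) (G' t y) t) (t₀ : ℝ) :
    HasDerivAt (fun t => ∫ y, G t y * wt y) (∫ y, G' t₀ y * wt y) t₀ := by
  obtain ⟨K, hK⟩ := ((isCompact_closedBall t₀ 1).prod
    (isCompact_closedBall (0 : EuclideanSpace ℝ (Fin n)) 1)).exists_bound_of_continuousOn
    hG'.continuousOn
  have hc : ∀ t, Continuous (G t) := fun t => hG.comp (by fun_prop : Continuous fun y => (t, y))
  have hc' : ∀ t, Continuous (G' t) := fun t => hG'.comp (by fun_prop : Continuous fun y => (t, y))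
  refine (hasDerivAt_integral_of_dominated_loc_of_deriv_le (F := fun t y => G t y * wt y)
    (F' := fun t y => G' t y * wt y) (bound := fun y => K * wt y) (s := Metric.closedBall t₀ 1)
    (Metric.closedBall_mem_nhds t₀ one_pos)
    (Filter.Eventually.of_forall fun t => (integ_wt (hc t)).aestronglyMeasurable)
    (integ_wt (hc t₀)) (integ_wt (hc' t₀)).aestronglyMeasurable
    (Filter.Eventually.of_forall fun y t ht => ?_) (integ_wt continuous_const)
    (Filter.Eventually.of_forall fun y t ht => (hd t y).mul_const _)).2
  rw [norm_mul, Real.norm_of_nonneg (wt_nonneg y)]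
  by_cases hy : 1 ≤ ‖y‖
  · rw [wt_zero hy]; simp
  · have := hK (t, y) ⟨ht, by rw [mem_closedBall_zero_iff]; exact (not_le.1 hy).le⟩
    exact mul_le_mul_of_nonneg_right this (wt_nonneg y)

lemma fderiv_scale {v : EuclideanSpace ℝ (Fin n) → ℝ} (hv : ContDiff ℝ ∞ v)
    (x : EuclideanSpace ℝ (Fin n)) (s : ℝ) (y a : EuclideanSpace ℝ (Fin n)) :
    fderiv ℝ (fun y => v (x + s • y)) y a = s * fderiv ℝ v (x + s • y) a := by
  have h1 : HasFDerivAt (fun y : EuclideanSpace ℝ (Fin n) => x + s • y)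
      (s • ContinuousLinearMap.id ℝ (EuclideanSpace ℝ (Fin n))) y :=
    ((hasFDerivAt_id y).const_smul s).const_add x
  have h2 := ((hv.differentiable (by simp)) (x + s • y)).hasFDerivAt.comp y h1
  have : (fun y => v (x + s • y)) = v ∘ (fun y => x + s • y) := rfl
  rw [this, h2.fderiv]
  simp

lemma smooth_scale {v : EuclideanSpace ℝ (Fin n) → ℝ} (hv : ContDiff ℝ ∞ v)
    (x : EuclideanSpace ℝ (Fin n)) (s : ℝ) : ContDiff ℝ ∞ (fun y => v (x + s • y)) :=
  hv.comp (by fun_prop)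

lemma lap_scale {v : EuclideanSpace ℝ (Fin n) → ℝ} (hv : ContDiff ℝ ∞ v)
    (x : EuclideanSpace ℝ (Fin n)) (s : ℝ) (y : EuclideanSpace ℝ (Fin n)) :
    lap (fun y => v (x + s • y)) y = s ^ 2 * lap v (x + s • y) := by
  unfold lap
  rw [Finset.mul_sum]
  refine Finset.sum_congr rfl fun i _ => ?_
  simp only [fderiv_scale hv]
  rw [fderiv_const_mul ((smooth_scale (smooth_D hv (bas i)) x s).differentiable (by simp) y)]
  have := fderiv_scale (smooth_D hv (bas i)) x s y (bas i)
  simp only [FunLike.coe_smul, Pi.smul_apply, smul_eq_mul]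
  rw [this]; ring

lemma lap_scale_zero {v : EuclideanSpace ℝ (Fin n) → ℝ} (hv : ContDiff ℝ ∞ v)
    {x : EuclideanSpace ℝ (Fin n)} {ρ : ℝ} (hl : ∀ y ∈ ball x ρ, lap v y = 0)
    {s : ℝ} (hs : 0 < s) (hs' : s ≤ ρ) :
    ∀ y ∈ ball (0 : EuclideanSpace ℝ (Fin n)) 1, lap (fun y => v (x + s • y)) y = 0 := by
  intro y hy
  rw [lap_scale hv, hl, mul_zero]
  rw [mem_ball_zero_iff] at hy
  rw [mem_ball_iff_norm, add_sub_cancel_left, norm_smul, Real.norm_of_nonneg hs.le]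
  nlinarith [norm_nonneg y]

lemma hasDerivAt_ray {v : EuclideanSpace ℝ (Fin n) → ℝ} (hv : ContDiff ℝ ∞ v)
    (x y : EuclideanSpace ℝ (Fin n)) (s : ℝ) :
    HasDerivAt (fun s : ℝ => v (x + s • y)) (fderiv ℝ v (x + s • y) y) s := by
  have h1 : HasDerivAt (fun s : ℝ => x + s • y) y s := by
    simpa using ((hasDerivAt_id s).smul_const y).const_add x
  exact ((hv.differentiable (by simp)) (x + s • y)).hasFDerivAt.comp_hasDerivAt s h1

/-- bilinear form at two radii -/
noncomputable def BB (v : EuclideanSpace ℝ (Fin n) → ℝ) (x : EuclideanSpace ℝ (Fin n)) (s t : ℝ) : ℝ :=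
  ∫ y, (v (x + s • y) * v (x + t • y)) * wt y

lemma BB_symm {v : EuclideanSpace ℝ (Fin n) → ℝ} (hv : ContDiff ℝ ∞ v)
    {x : EuclideanSpace ℝ (Fin n)} {ρ : ℝ} (hl : ∀ y ∈ ball x ρ, lap v y = 0)
    {s t : ℝ} (hs : 0 < s) (hs' : s ≤ ρ) (ht : 0 < t) (ht' : t ≤ ρ) :
    ∫ y, ((s * fderiv ℝ v (x + s • y) y) * v (x + t • y)) * wt y =
    ∫ y, (v (x + s • y) * (t * fderiv ℝ v (x + t • y) y)) * wt y := by
  have h1 := ibp (smooth_scale hv x s) (smooth_scale hv x t) (lap_scale_zero hv hl hs hs')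
  have h2 := ibp (smooth_scale hv x t) (smooth_scale hv x s) (lap_scale_zero hv hl ht ht')
  simp only [fderiv_scale hv] at h1 h2
  rw [h1]
  have h3 : ∀ y, (v (x + s • y) * (t * fderiv ℝ v (x + t • y) y)) * wt y
    = (t * fderiv ℝ v (x + t • y) y) * v (x + s • y) * wt y := fun y => by ring
  simp only [h3]
  rw [h2]
  congr 1; ext y
  congr 1
  exact Finset.sum_congr rfl fun i _ => by ring

lemma cont_fd {v : EuclideanSpace ℝ (Fin n) → ℝ} (hv : ContDiff ℝ ∞ v) : Continuous (fderiv ℝ v) :=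
  hv.continuous_fderiv (by simp)

lemma BB_geom {v : EuclideanSpace ℝ (Fin n) → ℝ} (hv : ContDiff ℝ ∞ v)
    {x : EuclideanSpace ℝ (Fin n)} {ρ : ℝ} (hl : ∀ y ∈ ball x ρ, lap v y = 0)
    {m q : ℝ} (hm : 0 < m) (hq : 1 ≤ q) (hq' : m * q ≤ ρ) :
    BB v x (m / q) (m * q) = BB v x m m := by
  have hvc := hv.continuous
  have hfc := cont_fd hv
  let G : ℝ → EuclideanSpace ℝ (Fin n) → ℝ := fun τ y =>
    v (x + (m * Real.exp (-τ)) • y) * v (x + (m * Real.exp τ) • y)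
  let G' : ℝ → EuclideanSpace ℝ (Fin n) → ℝ := fun τ y =>
    (fderiv ℝ v (x + (m * Real.exp (-τ)) • y) y * (m * (Real.exp (-τ) * (-1)))) * v (x + (m * Real.exp τ) • y)
    + v (x + (m * Real.exp (-τ)) • y) * (fderiv ℝ v (x + (m * Real.exp τ) • y) y * (m * Real.exp τ))
  have hd : ∀ τ, HasDerivAt (fun τ => ∫ y, G τ y * wt y) (∫ y, G' τ y * wt y) τ := by
    intro τ
    refine hasDerivAt_int (by fun_prop) ?_ ?_ τ
    · simp only [G']
      fun_prop
    · intro τ y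
      have h1 := (hasDerivAt_ray hv x y (m * Real.exp (-τ))).comp τ
        (((Real.hasDerivAt_exp (-τ)).comp τ (hasDerivAt_neg τ)).const_mul m)
      have h2 := (hasDerivAt_ray hv x y (m * Real.exp τ)).comp τ
        ((Real.hasDerivAt_exp τ).const_mul m)
      exact h1.mul h2
  have hz : ∀ τ, 0 ≤ τ → τ ≤ Real.log q → ∫ y, G' τ y * wt y = 0 := by
    intro τ h0 h1
    have e1 : Real.exp τ ≤ q := by
      rw [← Real.exp_log (show 0 < q by linarith)]; exact Real.exp_le_exp.2 h1
    have e2 : Real.exp (-τ) ≤ 1 := by rw [Real.exp_le_one_iff]; linarith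
    have e3 := Real.exp_pos τ
    have e4 := Real.exp_pos (-τ)
    have hs := BB_symm hv hl (s := m * Real.exp (-τ)) (t := m * Real.exp τ) (by positivity)
      (by nlinarith) (by positivity) (by nlinarith)
    have hsplit : ∀ y, G' τ y * wt y =
      (v (x + (m * Real.exp (-τ)) • y) * ((m * Real.exp τ) * fderiv ℝ v (x + (m * Real.exp τ) • y) y)) * wt y
      - (((m * Real.exp (-τ)) * fderiv ℝ v (x + (m * Real.exp (-τ)) • y) y) * v (x + (m * Real.exp τ) • y)) * wt y := by
      intro y; simp only [G']; ring
    simp only [hsplit]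
    rw [integral_sub (integ_wt (by fun_prop)) (integ_wt (by fun_prop)), hs, sub_self]
  have hlog : 0 ≤ Real.log q := Real.log_nonneg hq
  have hconst := constant_of_has_deriv_right_zero (f := fun τ => ∫ y, G τ y * wt y) (a := 0)
    (b := Real.log q) (fun τ _ => (hd τ).continuousAt.continuousWithinAt)
    (fun τ hτ => by
      have := (hd τ).hasDerivWithinAt (s := Set.Ici τ)
      rwa [hz τ hτ.1 hτ.2.le] at this) (Real.log q) ⟨hlog, le_rfl⟩
  simp only [G, Real.exp_neg, Real.exp_log (show 0 < q by linarith), Real.exp_zero, inv_one,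
    mul_one] at hconst
  unfold BB
  rw [div_eq_mul_inv]
  exact hconst

lemma BB_mono {v : EuclideanSpace ℝ (Fin n) → ℝ} (hv : ContDiff ℝ ∞ v)
    {x : EuclideanSpace ℝ (Fin n)} {ρ : ℝ} (hl : ∀ y ∈ ball x ρ, lap v y = 0) :
    MonotoneOn (fun r => BB v x r r) (Set.Icc 0 ρ) := by
  have hvc := hv.continuous
  have hfc := cont_fd hv
  have hd : ∀ r, HasDerivAt (fun r => BB v x r r)
      (∫ y, (fderiv ℝ v (x + r • y) y * v (x + r • y) + v (x + r • y) * fderiv ℝ v (x + r • y) y) * wt y) r := by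
    intro r
    refine hasDerivAt_int (G := fun r y => v (x + r • y) * v (x + r • y))
      (G' := fun r y => fderiv ℝ v (x + r • y) y * v (x + r • y) + v (x + r • y) * fderiv ℝ v (x + r • y) y)
      (by fun_prop) (by fun_prop) ?_ r
    intro r y
    exact (hasDerivAt_ray hv x y r).mul (hasDerivAt_ray hv x y r)
  refine monotoneOn_of_deriv_nonneg (convex_Icc 0 ρ)
    (fun r _ => (hd r).continuousAt.continuousWithinAt)
    (fun r _ => (hd r).differentiableAt.differentiableWithinAt) ?_
  intro r hr
  rw [interior_Icc] at hr
  rw [(hd r).deriv]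
  have h1 := ibp (smooth_scale hv x r) (smooth_scale hv x r) (lap_scale_zero hv hl hr.1 hr.2.le)
  simp only [fderiv_scale hv] at h1
  have h2 : 0 ≤ ∫ y, (r * fderiv ℝ v (x + r • y) y) * v (x + r • y) * wt y := by
    rw [h1]
    refine integral_nonneg fun y => mul_nonneg (Finset.sum_nonneg fun i _ => mul_self_nonneg _) (cutW_nonneg y)
  have h3 : ∫ y, (fderiv ℝ v (x + r • y) y * v (x + r • y) + v (x + r • y) * fderiv ℝ v (x + r • y) y) * wt y
     = 2 / r * ∫ y, (r * fderiv ℝ v (x + r • y) y) * v (x + r • y) * wt y := by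
    rw [← integral_const_mul]
    congr 1; ext y
    have := hr.1.ne'
    field_simp
    ring
  rw [h3]
  have := hr.1
  positivity

lemma norm_sq_clm (L : (EuclideanSpace ℝ (Fin n)) →L[ℝ] ℝ) : ‖L‖ ^ 2 = ∑ i, L (bas i) ^ 2 := by
  let z := (InnerProductSpace.toDual ℝ (EuclideanSpace ℝ (Fin n))).symm L
  have h1 : ‖z‖ = ‖L‖ := LinearIsometryEquiv.norm_map _ _
  have h2 : ∀ i, L (bas i) = z i := by
    intro i
    have : inner ℝ z (bas i) = L (bas i) := InnerProductSpace.toDual_symm_apply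
    rw [← this]; simp [bas, EuclideanSpace.inner_single_right]
  rw [← h1, EuclideanSpace.norm_sq_eq]
  simp [h2]

lemma D_comm {u : EuclideanSpace ℝ (Fin n) → ℝ} (hu : ContDiff ℝ ∞ u)
    (a b x : EuclideanSpace ℝ (Fin n)) :
    fderiv ℝ (fun y => fderiv ℝ u y a) x b = fderiv ℝ (fun y => fderiv ℝ u y b) x a := by
  have hd : DifferentiableAt ℝ (fderiv ℝ u) x :=
    (hu.fderiv_right (m := ∞) (by simp)).differentiable (by simp) x
  have h : ∀ a b, fderiv ℝ (fun y => fderiv ℝ u y a) x b = fderiv ℝ (fderiv ℝ u) x b a := by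
    intro a b
    rw [fderiv_clm_apply hd (differentiableAt_const a)]
    simp
  rw [h, h]
  exact (hu.contDiffAt.isSymmSndFDerivAt (by simp only [minSmoothness_of_isRCLikeNormedField]; exact WithTop.coe_le_coe.2 (le_top : (2 : ℕ∞) ≤ ⊤))) b a

lemma lap_D {u : EuclideanSpace ℝ (Fin n) → ℝ} (hu : ContDiff ℝ ∞ u)
    {x : EuclideanSpace ℝ (Fin n)} {ρ : ℝ} (hl : ∀ y ∈ ball x ρ, lap u y = 0) (i : Fin n) :
    ∀ y ∈ ball x ρ, lap (fun z => fderiv ℝ u z (bas i)) y = 0 := by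
  intro y hy
  have h1 : lap (fun z => fderiv ℝ u z (bas i)) y = fderiv ℝ (lap u) y (bas i) := by
    unfold lap
    rw [fderiv_fun_sum (fun j _ => (smooth_D (smooth_D hu (bas j)) (bas j)).differentiable (by simp) y)]
    rw [_root_.sum_apply]
    refine Finset.sum_congr rfl fun j _ => ?_
    have h2 : (fun z => fderiv ℝ (fun z => fderiv ℝ u z (bas i)) z (bas j))
      = fun z => fderiv ℝ (fun z => fderiv ℝ u z (bas j)) z (bas i) := by
      ext z; exact D_comm hu _ _ _
    rw [h2]
    exact D_comm (smooth_D hu (bas j)) _ _ _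
  rw [h1]
  have h3 : lap u =ᶠ[nhds y] fun _ => 0 := by
    filter_upwards [isOpen_ball.mem_nhds hy] with z hz
    exact hl z hz
  rw [h3.fderiv_eq]; simp

noncomputable def HH (u : EuclideanSpace ℝ (Fin n) → ℝ) (x : EuclideanSpace ℝ (Fin n)) (r : ℝ) : ℝ :=
  ∫ y, ‖fderiv ℝ u (x + r • y)‖ ^ 2 * wt y

lemma HH_eq {u : EuclideanSpace ℝ (Fin n) → ℝ} (hu : ContDiff ℝ ∞ u)
    (x : EuclideanSpace ℝ (Fin n)) (r : ℝ) :
    HH u x r = ∑ i, BB (fun z => fderiv ℝ u z (bas i)) x r r := by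
  unfold HH BB
  have hc := cont_fd hu
  rw [← integral_finsetSum]
  · congr 1; ext y
    rw [norm_sq_clm, ← Finset.sum_mul]
    congr 1
    exact Finset.sum_congr rfl fun i _ => by ring
  · intro i _
    exact integ_wt (by fun_prop)

lemma HH_nonneg (u : EuclideanSpace ℝ (Fin n) → ℝ) (x : EuclideanSpace ℝ (Fin n)) (r : ℝ) :
    0 ≤ HH u x r :=
  integral_nonneg fun y => mul_nonneg (by positivity) (wt_nonneg y)

lemma HH_mono {u : EuclideanSpace ℝ (Fin n) → ℝ} (hu : ContDiff ℝ ∞ u)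
    {x : EuclideanSpace ℝ (Fin n)} {ρ : ℝ} (hl : ∀ y ∈ ball x ρ, lap u y = 0)
    {s t : ℝ} (hs : 0 ≤ s) (hst : s ≤ t) (ht : t ≤ ρ) : HH u x s ≤ HH u x t := by
  rw [HH_eq hu, HH_eq hu]
  exact Finset.sum_le_sum fun i _ => BB_mono (smooth_D hu (bas i)) (lap_D hu hl i)
    ⟨hs, hst.trans ht⟩ ⟨hs.trans hst, ht⟩ hst

lemma HH_geom {u : EuclideanSpace ℝ (Fin n) → ℝ} (hu : ContDiff ℝ ∞ u)
    {x : EuclideanSpace ℝ (Fin n)} {ρ : ℝ} (hl : ∀ y ∈ ball x ρ, lap u y = 0)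
    {m q : ℝ} (hm : 0 < m) (hq : 1 ≤ q) (hq' : m * q ≤ ρ) :
    HH u x m ^ 2 ≤ HH u x (m / q) * HH u x (m * q) := by
  have hc := cont_fd hu
  have key : ∀ k : ℝ, 0 ≤ HH u x (m * q) * (k * k) + (-(2 * HH u x m)) * k + HH u x (m / q) := by
    intro k
    have e : HH u x (m * q) * (k * k) + (-(2 * HH u x m)) * k + HH u x (m / q)
      = ∑ i, ∫ y, (fderiv ℝ u (x + (m / q) • y) (bas i) - k * fderiv ℝ u (x + (m * q) • y) (bas i)) ^ 2 * wt y := by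
      rw [HH_eq hu, HH_eq hu, HH_eq hu, Finset.sum_mul, Finset.mul_sum, ← Finset.sum_neg_distrib,
        Finset.sum_mul, ← Finset.sum_add_distrib, ← Finset.sum_add_distrib]
      refine Finset.sum_congr rfl fun i _ => ?_
      rw [← BB_geom (smooth_D hu (bas i)) (lap_D hu hl i) hm hq hq']
      unfold BB
      have : ∀ y, (fderiv ℝ u (x + (m / q) • y) (bas i) - k * fderiv ℝ u (x + (m * q) • y) (bas i)) ^ 2 * wt y
        = ((k * k) * ((fderiv ℝ u (x + (m * q) • y) (bas i) * fderiv ℝ u (x + (m * q) • y) (bas i)) * wt y)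
         + (-2 * k) * ((fderiv ℝ u (x + (m / q) • y) (bas i) * fderiv ℝ u (x + (m * q) • y) (bas i)) * wt y))
         + (fderiv ℝ u (x + (m / q) • y) (bas i) * fderiv ℝ u (x + (m / q) • y) (bas i)) * wt y := by
        intro y; ring
      simp only [this]
      have i1 : Integrable (fun y => (fderiv ℝ u (x + (m * q) • y) (bas i) * fderiv ℝ u (x + (m * q) • y) (bas i)) * wt y) :=
        integ_wt (by fun_prop)
      have i2 : Integrable (fun y => (fderiv ℝ u (x + (m / q) • y) (bas i) * fderiv ℝ u (x + (m * q) • y) (bas i)) * wt y) :=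
        integ_wt (by fun_prop)
      have i3 : Integrable (fun y => (fderiv ℝ u (x + (m / q) • y) (bas i) * fderiv ℝ u (x + (m / q) • y) (bas i)) * wt y) :=
        integ_wt (by fun_prop)
      have i4 : Integrable (fun y => (k * k) * ((fderiv ℝ u (x + (m * q) • y) (bas i) * fderiv ℝ u (x + (m * q) • y) (bas i)) * wt y)
         + (-2 * k) * ((fderiv ℝ u (x + (m / q) • y) (bas i) * fderiv ℝ u (x + (m * q) • y) (bas i)) * wt y)) :=
        (i1.const_mul _).add (i2.const_mul _)
      rw [integral_add i4 i3,
        integral_add (i1.const_mul _) (i2.const_mul _), integral_const_mul, integral_const_mul]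
      ring
    rw [e]
    exact Finset.sum_nonneg fun i _ => integral_nonneg fun y => mul_nonneg (by positivity) (wt_nonneg y)
  have := discrim_le_zero key
  unfold discrim at this
  nlinarith

lemma bdd_grad {u : EuclideanSpace ℝ (Fin n) → ℝ} (hu : ContDiff ℝ ∞ u)
    (x : EuclideanSpace ℝ (Fin n)) (r : ℝ) :
    BddAbove ((fun x => ‖fderiv ℝ u x‖) '' ball x r) := by
  have := (isCompact_closedBall x r).bddAbove_image ((cont_fd hu).norm.continuousOn)
  exact this.mono (Set.image_mono ball_subset_closedBall)

lemma le_supGrad {u : EuclideanSpace ℝ (Fin n) → ℝ} (hu : ContDiff ℝ ∞ u)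
    {x y : EuclideanSpace ℝ (Fin n)} {r : ℝ} (hy : y ∈ ball x r) :
    ‖fderiv ℝ u y‖ ≤ supGrad u (ball x r) :=
  le_csSup (bdd_grad hu x r) ⟨y, hy, rfl⟩

lemma supGrad_nonneg (u : EuclideanSpace ℝ (Fin n) → ℝ) (s : Set (EuclideanSpace ℝ (Fin n))) :
    0 ≤ supGrad u s :=
  Real.sSup_nonneg (by rintro _ ⟨y, _, rfl⟩; exact norm_nonneg _)

lemma supGrad_le {u : EuclideanSpace ℝ (Fin n) → ℝ} {s : Set (EuclideanSpace ℝ (Fin n))} {a : ℝ}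
    (ha : 0 ≤ a) (h : ∀ y ∈ s, ‖fderiv ℝ u y‖ ≤ a) : supGrad u s ≤ a :=
  Real.sSup_le (by rintro _ ⟨y, hy, rfl⟩; exact h y hy) ha

lemma supGrad_mono {u : EuclideanSpace ℝ (Fin n) → ℝ} (hu : ContDiff ℝ ∞ u)
    {x x' : EuclideanSpace ℝ (Fin n)} {r r' : ℝ} (h : ball x r ⊆ ball x' r') :
    supGrad u (ball x r) ≤ supGrad u (ball x' r') :=
  supGrad_le (supGrad_nonneg _ _) fun _ hy => le_supGrad hu (h hy)

noncomputable def W0 (n : ℕ) : ℝ := ∫ y : EuclideanSpace ℝ (Fin n), wt y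

lemma HH_le {u : EuclideanSpace ℝ (Fin n) → ℝ} (hu : ContDiff ℝ ∞ u)
    (x : EuclideanSpace ℝ (Fin n)) {r : ℝ} (hr : 0 < r) :
    HH u x r ≤ W0 n * supGrad u (ball x r) ^ 2 := by
  have hc := cont_fd hu
  unfold HH W0
  rw [mul_comm, ← integral_const_mul]
  refine integral_mono (integ_wt (by fun_prop)) (integ_wt continuous_const) fun y => ?_
  by_cases hy : 1 ≤ ‖y‖
  · simp [wt_zero hy]
  · have hm : x + r • y ∈ ball x r := by
      rw [mem_ball_iff_norm, add_sub_cancel_left, norm_smul, Real.norm_of_nonneg hr.le]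
      nlinarith [norm_nonneg y]
    have := le_supGrad hu hm
    have h0 := wt_nonneg y
    simp only
    gcongr

lemma supGrad_le_HH {u : EuclideanSpace ℝ (Fin n) → ℝ} (hu : ContDiff ℝ ∞ u)
    {x : EuclideanSpace ℝ (Fin n)} {R : ℝ} (hR : 0 < R) (hl : ∀ y ∈ ball x (2 * R), lap u y = 0) :
    supGrad u (ball x R) ^ 2 ≤ (6 * 4 ^ n / W0 n) * HH u x (2 * R) := by
  have hc := cont_fd hu
  have hW : 0 < W0 n := wt_int_pos
  have hpt : ∀ z ∈ ball x R, ‖fderiv ℝ u z‖ ^ 2 ≤ (6 * 4 ^ n / W0 n) * HH u x (2 * R) := by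
    intro z hz
    rw [mem_ball_iff_norm] at hz
    have h1 : HH u z 0 ≤ HH u z (R / 2) := by
      refine HH_mono hu (ρ := R / 2) ?_ le_rfl (by positivity) le_rfl
      intro y hy
      refine hl y ?_
      rw [mem_ball_iff_norm] at hy ⊢
      have := norm_sub_le_norm_sub_add_norm_sub y z x
      linarith
    have h2 : HH u z 0 = ‖fderiv ℝ u z‖ ^ 2 * W0 n := by
      unfold HH W0
      simp only [_root_.zero_smul, add_zero]
      rw [integral_const_mul]
    let F : EuclideanSpace ℝ (Fin n) → ℝ := fun y => ‖fderiv ℝ u (x + (2 * R) • y)‖ ^ 2 * wt y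
    let a : EuclideanSpace ℝ (Fin n) := (2 * R)⁻¹ • (z - x)
    have ha : ‖a‖ ≤ 1 / 2 := by
      simp only [a]
      rw [norm_smul, Real.norm_of_nonneg (by positivity), inv_mul_le_iff₀ (by positivity)]
      linarith
    have hFi : Integrable F := integ_wt (by fun_prop)
    have hFi2 : Integrable (fun y => F ((1 / 4 : ℝ) • y + a)) := by
      have h3 : Integrable (fun y => F (y + a)) := hFi.comp_add_right a
      exact h3.comp_smul (by norm_num : (1 / 4 : ℝ) ≠ 0)
    have h4 : ∫ y, F ((1 / 4 : ℝ) • y + a) = 4 ^ n * HH u x (2 * R) := by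
      have h5 := Measure.integral_comp_smul volume (fun y => F (y + a)) (1 / 4 : ℝ)
      rw [h5, integral_add_right_eq_self F a]
      have h6 : |((1 / 4 : ℝ) ^ Module.finrank ℝ (EuclideanSpace ℝ (Fin n)))⁻¹| = 4 ^ n := by
        rw [finrank_euclideanSpace_fin, abs_of_nonneg (by positivity)]
        simp
      rw [h6]; rfl
    have h7 : HH u z (R / 2) ≤ ∫ y, 6 * F ((1 / 4 : ℝ) • y + a) := by
      unfold HH
      refine integral_mono (integ_wt (by fun_prop)) (hFi2.const_mul 6) fun y => ?_
      simp only [F]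
      have h8 : x + (2 * R) • ((1 / 4 : ℝ) • y + a) = z + (R / 2) • y := by
        simp only [a]
        rw [smul_add, smul_smul, smul_smul, mul_inv_cancel₀ (by positivity), one_smul]
        have : 2 * R * (1 / 4) = R / 2 := by ring
        rw [this]; abel
      rw [h8]
      by_cases hy : 1 ≤ ‖y‖
      · rw [wt_zero hy]
        have := wt_nonneg ((1 / 4 : ℝ) • y + a)
        rw [mul_zero]
        positivity
      · have h9 : ‖(1 / 4 : ℝ) • y + a‖ ≤ 3 / 4 := by
          refine (norm_add_le _ _).trans ?_
          rw [norm_smul, Real.norm_of_nonneg (by norm_num)]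
          linarith
        have h10 := one_le_wt h9
        have h11 := wt_le y
        have h12 : wt y ≤ 6 * wt ((1 / 4 : ℝ) • y + a) := by linarith
        calc _ ≤ ‖fderiv ℝ u (z + (R / 2) • y)‖ ^ 2 * (6 * wt ((1 / 4 : ℝ) • y + a)) := by gcongr
          _ = _ := by ring
    rw [integral_const_mul, h4] at h7
    rw [div_mul_eq_mul_div, le_div_iff₀ hW]
    linarith
  have h0 : 0 ≤ (6 * 4 ^ n / W0 n) * HH u x (2 * R) :=
    mul_nonneg (by positivity) (HH_nonneg _ _ _)
  have := supGrad_le (u := u) (s := ball x R) (Real.sqrt_nonneg ((6 * 4 ^ n / W0 n) * HH u x (2 * R)))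
    (fun z hz => Real.le_sqrt_of_sq_le (hpt z hz))
  calc _ ≤ (√((6 * 4 ^ n / W0 n) * HH u x (2 * R))) ^ 2 := by
        gcongr; exact supGrad_nonneg _ _
    _ = _ := Real.sq_sqrt h0

lemma cmp_bounds {u : EuclideanSpace ℝ (Fin n) → ℝ} (hu : ContDiff ℝ ∞ u)
    {x : EuclideanSpace ℝ (Fin n)} {R : ℝ} (hR : 0 < R) (hl : ∀ y ∈ ball x (2 * R), lap u y = 0) :
    W0 n * supGrad u (ball x R) ^ 2 ≤ (6 * 4 ^ n) * HH u x (2 * R) := by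
  have hW : 0 < W0 n := wt_int_pos
  have := supGrad_le_HH hu hR hl
  rw [div_mul_eq_mul_div, le_div_iff₀ hW] at this
  linarith

lemma growth {u : EuclideanSpace ℝ (Fin n) → ℝ} (hu : ContDiff ℝ ∞ u) (hn : 1 ≤ n)
    {x : EuclideanSpace ℝ (Fin n)} {ℓ : ℝ} (hℓ : 0 < ℓ) (hl : ∀ y ∈ ball x (8 * ℓ), lap u y = 0)
    (m : ℕ) (hm : (20 * n : ℝ) ≤ 2 ^ m) {r : ℝ} (hr : 0 < r) (hrℓ : r ≤ ℓ)
    (hpos : 0 < supGrad u (ball x ℓ)) :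
    supGrad u (ball x (10 * n * r)) ^ 2 ≤ (6 * 4 ^ n) *
      ((6 * 4 ^ n) * (supGrad u (ball x (10 * n * ℓ)) / supGrad u (ball x ℓ)) ^ 2) ^ (m + 1) *
      supGrad u (ball x r) ^ 2 := by
  have hW : 0 < W0 n := wt_int_pos
  have hn' : (1 : ℝ) ≤ n := by exact_mod_cast hn
  set A : ℝ := 6 * 4 ^ n with hA
  have hA1 : 1 ≤ A := by
    have : (1 : ℝ) ≤ 4 ^ n := one_le_pow₀ (by norm_num)
    linarith
  set R := supGrad u (ball x (10 * n * ℓ)) / supGrad u (ball x ℓ) with hRdef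
  have hR1 : 1 ≤ R := by
    rw [hRdef, one_le_div hpos]
    exact supGrad_mono hu (ball_subset_ball (by nlinarith))
  set Q := A * R ^ 2 with hQ
  have hRQ : R ^ 2 ≤ Q := by nlinarith [sq_nonneg R]
  have hQ1 : 1 ≤ Q := by nlinarith
  have hmono : ∀ {s t : ℝ}, 0 ≤ s → s ≤ t → t ≤ 8 * ℓ → HH u x s ≤ HH u x t :=
    fun hs hst ht => HH_mono hu hl hs hst ht
  let b : ℕ → ℝ := fun k => HH u x (4 * ℓ / 2 ^ k)
  have hb0 : ∀ k, 0 ≤ b k := fun k => HH_nonneg _ _ _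
  have hcmp : ∀ {ρ : ℝ}, 0 < ρ → 2 * ρ ≤ 8 * ℓ →
      W0 n * supGrad u (ball x ρ) ^ 2 ≤ A * HH u x (2 * ρ) := fun h0 h1 =>
    cmp_bounds hu h0 fun y hy => hl y (ball_subset_ball h1 hy)
  have hb1 : b 1 = HH u x (2 * ℓ) := by
    simp only [b]; congr 1; ring
  have hstep : ∀ k, b k ≤ Q * b (k + 1) := by
    intro k
    induction k with
    | zero =>
      have h1 : b 0 ≤ W0 n * supGrad u (ball x (4 * ℓ)) ^ 2 := by
        simpa [b] using HH_le hu x (r := 4 * ℓ) (by positivity)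
      have h2 : supGrad u (ball x (4 * ℓ)) ≤ supGrad u (ball x (10 * n * ℓ)) :=
        supGrad_mono hu (ball_subset_ball (by nlinarith))
      have h3 : supGrad u (ball x (10 * n * ℓ)) = R * supGrad u (ball x ℓ) := by
        rw [hRdef, div_mul_cancel₀ _ hpos.ne']
      have h4 := hcmp hℓ (by linarith)
      have h5 := supGrad_nonneg u (ball x (4 * ℓ))
      rw [zero_add, hb1]
      calc b 0 ≤ W0 n * supGrad u (ball x (4 * ℓ)) ^ 2 := h1
        _ ≤ W0 n * (R * supGrad u (ball x ℓ)) ^ 2 := by rw [← h3]; gcongr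
        _ = R ^ 2 * (W0 n * supGrad u (ball x ℓ) ^ 2) := by ring
        _ ≤ R ^ 2 * (A * HH u x (2 * ℓ)) := by gcongr
        _ = Q * HH u x (2 * ℓ) := by rw [hQ]; ring
    | succ k ih =>
      have h2k : (1 : ℝ) ≤ 2 ^ k := one_le_pow₀ (by norm_num)
      have hle : 4 * ℓ / 2 ^ (k + 1) * 2 ≤ 8 * ℓ := by
        rw [pow_succ]
        have : 4 * ℓ / (2 ^ k * 2) * 2 = 4 * ℓ / 2 ^ k := by field_simp
        rw [this, div_le_iff₀ (by positivity)]
        nlinarith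
      have h1 := HH_geom hu hl (m := 4 * ℓ / 2 ^ (k + 1)) (q := 2) (by positivity) (by norm_num) hle
      have e1 : 4 * ℓ / 2 ^ (k + 1) / 2 = 4 * ℓ / 2 ^ (k + 1 + 1) := by
        rw [pow_succ 2 (k + 1)]; field_simp
      have e2 : 4 * ℓ / 2 ^ (k + 1) * 2 = 4 * ℓ / 2 ^ k := by
        rw [pow_succ]; field_simp
      rw [e1, e2] at h1
      change b (k + 1) ^ 2 ≤ b (k + 1 + 1) * b k at h1
      rcases (hb0 (k + 1)).eq_or_lt with h0 | h0
      · rw [← h0]; have := hb0 (k + 1 + 1); positivity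
      · have h2 : b (k + 1) * b (k + 1) ≤ (Q * b (k + 1 + 1)) * b (k + 1) := by
          calc b (k + 1) * b (k + 1) = b (k + 1) ^ 2 := by ring
            _ ≤ b (k + 1 + 1) * b k := h1
            _ ≤ b (k + 1 + 1) * (Q * b (k + 1)) := by gcongr; exact hb0 _
            _ = _ := by ring
        exact le_of_mul_le_mul_right h2 h0
  have hsteps : ∀ j k, b k ≤ Q ^ j * b (k + j) := by
    intro j
    induction j with
    | zero => intro k; simp
    | succ j ih =>
      intro k
      calc b k ≤ Q ^ j * b (k + j) := ih k
        _ ≤ Q ^ j * (Q * b (k + j + 1)) := by gcongr; exact hstep _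
        _ = Q ^ (j + 1) * b (k + (j + 1)) := by rw [pow_succ, add_assoc]; ring
  have hHr := HH_le hu x hr
  have hS := sq_nonneg (supGrad u (ball x r))
  refine le_of_mul_le_mul_left ?_ hW
  by_cases hc : 5 * n * r ≤ ℓ
  · obtain ⟨k, hk1, hk2⟩ := exists_nat_pow_near_of_lt_one (x := 5 * n * r / ℓ) (y := (1 / 2 : ℝ))
      (by positivity) (by rwa [div_le_one hℓ]) (by norm_num) (by norm_num)
    have h1 := hcmp (ρ := 10 * n * r) (by positivity) (by nlinarith)
    rw [lt_div_iff₀ hℓ] at hk1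
    rw [div_le_iff₀ hℓ] at hk2
    have hk2' : 2 * (10 * n * r) ≤ 4 * ℓ / 2 ^ k := by
      have : 4 * ℓ / 2 ^ k = 4 * ((1 / 2) ^ k * ℓ) := by rw [one_div, inv_pow]; ring
      rw [this]; linarith
    have h2k : 4 * ℓ / 2 ^ k ≤ 8 * ℓ := by
      have h2k : (1 : ℝ) ≤ 2 ^ k := one_le_pow₀ (by norm_num)
      rw [div_le_iff₀ (by positivity)]; nlinarith
    have h2 : HH u x (2 * (10 * n * r)) ≤ b k := hmono (by positivity) hk2' h2k
    have h3 : b (k + (m + 1)) ≤ HH u x r := by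
      refine hmono (by positivity) ?_ (by linarith)
      have : 4 * ℓ / 2 ^ (k + (m + 1)) = 4 * ((1 / 2) ^ (k + 1) * ℓ) / 2 ^ m := by
        rw [one_div, inv_pow, show k + (m + 1) = (k + 1) + m by ring, pow_add 2 (k + 1) m]
        field_simp
      rw [this, div_le_iff₀ (by positivity)]
      nlinarith
    calc W0 n * supGrad u (ball x (10 * n * r)) ^ 2 ≤ A * HH u x (2 * (10 * n * r)) := h1
      _ ≤ A * (Q ^ (m + 1) * b (k + (m + 1))) := by gcongr; exact h2.trans (hsteps _ _)
      _ ≤ A * (Q ^ (m + 1) * (W0 n * supGrad u (ball x r) ^ 2)) := by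
          gcongr; exact h3.trans hHr
      _ = _ := by ring
  · have h0 : supGrad u (ball x (10 * n * r)) ≤ R * supGrad u (ball x ℓ) := by
      rw [hRdef, div_mul_cancel₀ _ hpos.ne']
      exact supGrad_mono hu (ball_subset_ball (by gcongr))
    have h1 := hcmp hℓ (by linarith)
    rw [← hb1] at h1
    have h3 : b (1 + m) ≤ HH u x r := by
      refine hmono (by positivity) ?_ (by linarith)
      rw [div_le_iff₀ (by positivity), pow_add]
      push Not at hc
      nlinarith
    have h00 := supGrad_nonneg u (ball x (10 * n * r))
    calc W0 n * supGrad u (ball x (10 * n * r)) ^ 2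
        ≤ W0 n * (R * supGrad u (ball x ℓ)) ^ 2 := by gcongr
      _ = R ^ 2 * (W0 n * supGrad u (ball x ℓ) ^ 2) := by ring
      _ ≤ Q * (A * (Q ^ m * b (1 + m))) := by
          refine mul_le_mul hRQ (h1.trans ?_) (by positivity) (by positivity)
          gcongr; exact hsteps _ _
      _ ≤ Q * (A * (Q ^ m * (W0 n * supGrad u (ball x r) ^ 2))) := by
          gcongr; exact h3.trans hHr
      _ = _ := by rw [pow_succ]; ring

lemma zero_prop {u : EuclideanSpace ℝ (Fin n) → ℝ} (hu : ContDiff ℝ ∞ u)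
    {x : EuclideanSpace ℝ (Fin n)} {ℓ : ℝ} (hℓ : 0 < ℓ) (hl : ∀ y ∈ ball x (8 * ℓ), lap u y = 0)
    (hz : supGrad u (ball x ℓ) = 0) : supGrad u (ball x (2 * ℓ)) = 0 := by
  have hW : 0 < W0 n := wt_int_pos
  have h1 : HH u x ℓ = 0 := le_antisymm (by simpa [hz] using HH_le hu x hℓ) (HH_nonneg _ _ _)
  have h2 : HH u x (2 * ℓ) = 0 := by
    have := HH_geom hu hl (m := 2 * ℓ) (q := 2) (by positivity) (by norm_num) (by linarith)
    rw [show 2 * ℓ / 2 = ℓ by ring, h1, zero_mul] at this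
    exact pow_eq_zero_iff (two_ne_zero) |>.1 (le_antisymm this (sq_nonneg _))
  have h3 : HH u x (2 * (2 * ℓ)) = 0 := by
    have := HH_geom hu hl (m := 2 * (2 * ℓ)) (q := 2) (by positivity) (by norm_num) (by linarith)
    rw [show 2 * (2 * ℓ) / 2 = 2 * ℓ by ring, h2, zero_mul] at this
    exact pow_eq_zero_iff (two_ne_zero) |>.1 (le_antisymm this (sq_nonneg _))
  have h4 := supGrad_le_HH hu (x := x) (R := 2 * ℓ) (by positivity)
    (fun y hy => hl y (ball_subset_ball (by linarith) hy))
  rw [h3, mul_zero] at h4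
  exact pow_eq_zero_iff (two_ne_zero) |>.1 (le_antisymm h4 (sq_nonneg _))

lemma cube_compact (c : EuclideanSpace ℝ (Fin n)) (ℓ : ℝ) : IsCompact (cube c ℓ) := by
  have h : cube c ℓ = (EuclideanSpace.equiv (Fin n) ℝ).toHomeomorph ⁻¹'
      (Set.Icc (fun i => c i - ℓ / 2) (fun i => c i + ℓ / 2)) := by
    ext x
    simp only [cube, Set.mem_ofPred_eq, Set.mem_preimage, Set.mem_Icc, Pi.le_def, abs_le]
    constructor
    · intro h
      exact ⟨fun i => by have := (h i).1; change c i - ℓ / 2 ≤ x i; linarith,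
        fun i => by have := (h i).2; change x i ≤ c i + ℓ / 2; linarith⟩
    · intro h i
      have h1 : c i - ℓ / 2 ≤ x i := h.1 i
      have h2 : x i ≤ c i + ℓ / 2 := h.2 i
      constructor <;> linarith
  rw [h, Homeomorph.isCompact_preimage]
  exact isCompact_Icc

lemma cutoff {u : EuclideanSpace ℝ (Fin n) → ℝ} {K : Set (EuclideanSpace ℝ (Fin n))}
    {a b : ℝ} (ha : 0 < a) (hab : a < b)
    (hu : ContDiffOn ℝ (⊤ : ℕ∞) u (thickening b K)) :
    ∃ v : EuclideanSpace ℝ (Fin n) → ℝ, ContDiff ℝ ∞ v ∧ ∀ y ∈ thickening a K, v y = u y := by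
  obtain ⟨d, h1, h2⟩ := exists_between hab
  have hsub : cthickening a K ⊆ interior (cthickening d K) :=
    (cthickening_subset_thickening' (ha.trans h1) h1 K).trans (thickening_subset_interior_cthickening d K)
  obtain ⟨f, hf1, hf0, -⟩ := exists_contMDiffMap_one_nhds_of_subset_interior
    (n := (⊤ : ℕ∞)) (modelWithCornersSelf ℝ (EuclideanSpace ℝ (Fin n))) (isClosed_cthickening (E := K) (δ := a)) hsub
  have hfs : ContDiff ℝ ∞ (f : EuclideanSpace ℝ (Fin n) → ℝ) := f.contMDiff.contDiff
  refine ⟨fun y => f y * u y, ?_, ?_⟩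
  · rw [contDiff_iff_contDiffAt]
    intro y
    by_cases hy : y ∈ thickening b K
    · exact hfs.contDiffAt.mul (hu.contDiffAt (isOpen_thickening.mem_nhds hy))
    · have hy' : y ∉ cthickening d K := fun h =>
        hy (cthickening_subset_thickening' (ha.trans hab) h2 K h)
      have : (fun y => f y * u y) =ᶠ[nhds y] fun _ => 0 := by
        filter_upwards [isClosed_cthickening.isOpen_compl.mem_nhds hy'] with z hz
        rw [hf0 z hz, zero_mul]
      exact contDiffAt_const.congr_of_eventuallyEq this
  · intro y hy
    have := (Filter.Eventually.self_of_nhdsSet hf1) y (thickening_subset_cthickening a K hy)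
    simp only
    rw [this, one_mul]

end CMD

open CMD in
/-- **Comparability of maximal doubling and doubling:** there are dimensional constants
`C₀, C > 0` such that
`N(Q) ≤ C₀ + C · sup_{x ∈ Q} log ( sup_{B(x,10nℓ(Q))} |∇u| / sup_{B(x,ℓ(Q))} |∇u| )`. -/
theorem comparability_maximal_doubling (n : ℕ) :
    ∃ C₀ C : ℝ, 0 < C₀ ∧ 0 < C ∧
      ∀ (u : EuclideanSpace ℝ (Fin n) → ℝ) (c : EuclideanSpace ℝ (Fin n)) (ℓ : ℝ),
        0 < ℓ →
        IsHarmonicOn u (Metric.thickening ((20 * n + 1) * ℓ) (cube c ℓ)) →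
        cubeDoublingIndex u c ℓ ≤ C₀ + C * sSup {t | ∃ x ∈ cube c ℓ,
          t = Real.log (supGrad u (ball x (10 * n * ℓ)) / supGrad u (ball x ℓ))} := by
  classical
  rcases Nat.eq_zero_or_pos n with hn0 | hn
  · subst hn0
    refine ⟨1, 1, one_pos, one_pos, ?_⟩
    intro u c ℓ _ _
    have hz : ∀ (x : EuclideanSpace ℝ (Fin 0)) (r : ℝ),
        supGrad u (ball x (10 * ((0 : ℕ) : ℝ) * r)) = 0 := by
      intro x r; simp [supGrad]
    have h1 : cubeDoublingIndex u c ℓ ≤ 0 := by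
      refine Real.sSup_le ?_ le_rfl
      rintro t ⟨x, -, r, -, -, rfl⟩
      rw [hz]; simp
    have h2 : 0 ≤ sSup {t | ∃ x ∈ cube c ℓ,
          t = Real.log (supGrad u (ball x (10 * ((0 : ℕ) : ℝ) * ℓ)) / supGrad u (ball x ℓ))} := by
      refine Real.sSup_nonneg ?_
      rintro t ⟨x, -, rfl⟩
      rw [hz]; simp
    linarith
  have hn1 : (1 : ℝ) ≤ n := by exact_mod_cast hn
  set m : ℕ := 20 * n with hm
  have hm2 : (20 * n : ℝ) ≤ 2 ^ m := by
    have : (20 * n : ℕ) ≤ 2 ^ m := Nat.lt_two_pow_self.le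
    exact_mod_cast this
  have hA1 : (1 : ℝ) < 6 * 4 ^ n := by
    have : (1 : ℝ) ≤ 4 ^ n := one_le_pow₀ (by norm_num)
    linarith
  have hlogA : 0 < Real.log (6 * 4 ^ n) := Real.log_pos hA1
  refine ⟨(m + 2) * Real.log (6 * 4 ^ n), m + 1, by positivity, by positivity, ?_⟩
  intro u c ℓ hℓ ⟨hsm, hlap⟩
  have hab : (10 * n + 1) * ℓ < (20 * n + 1) * ℓ := by nlinarith
  obtain ⟨v, hv, hvu⟩ := cutoff (a := (10 * n + 1) * ℓ) (by positivity) hab hsm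
  have hV : ∀ y ∈ thickening ((10 * n + 1) * ℓ) (cube c ℓ), v =ᶠ[nhds y] u := fun y hy => by
    filter_upwards [isOpen_thickening.mem_nhds hy] with z hz using hvu z hz
  have hfd : ∀ y ∈ thickening ((10 * n + 1) * ℓ) (cube c ℓ), fderiv ℝ v y = fderiv ℝ u y :=
    fun y hy => (hV y hy).fderiv_eq
  have hlv : ∀ y ∈ thickening ((10 * n + 1) * ℓ) (cube c ℓ), lap v y = 0 := by
    intro y hy
    rw [← hlap y (thickening_mono hab.le _ hy)]
    unfold lap
    refine Finset.sum_congr rfl fun i _ => ?_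
    have : (fun z => fderiv ℝ v z (bas i)) =ᶠ[nhds y] fun z => fderiv ℝ u z (bas i) := by
      filter_upwards [isOpen_thickening.mem_nhds hy] with z hz
      rw [hfd z hz]
    rw [this.fderiv_eq]; rfl
  have hball : ∀ x ∈ cube c ℓ, ∀ r ≤ 10 * n * ℓ, ball x r ⊆ thickening ((10 * n + 1) * ℓ) (cube c ℓ) := by
    intro x hx r hr
    exact (ball_subset_ball (by linarith)).trans (ball_subset_thickening hx _)
  have hsup : ∀ x ∈ cube c ℓ, ∀ r ≤ 10 * n * ℓ, supGrad u (ball x r) = supGrad v (ball x r) := by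
    intro x hx r hr
    unfold supGrad
    congr 1
    refine Set.image_congr fun y hy => ?_
    rw [hfd y (hball x hx r hr hy)]
  have hl8 : ∀ x ∈ cube c ℓ, ∀ y ∈ ball x (8 * ℓ), lap v y = 0 :=
    fun x hx y hy => hlv y (hball x hx (8 * ℓ) (by nlinarith) hy)
  set S := {t | ∃ x ∈ cube c ℓ,
          t = Real.log (supGrad u (ball x (10 * n * ℓ)) / supGrad u (ball x ℓ))} with hS
  have hSnn : ∀ t ∈ S, 0 ≤ t := by
    rintro t ⟨x, hx, rfl⟩
    rw [hsup x hx _ le_rfl, hsup x hx ℓ (by nlinarith)]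
    rcases (supGrad_nonneg v (ball x ℓ)).eq_or_lt with h | h
    · rw [← h]; simp
    · refine Real.log_nonneg ?_
      rw [one_le_div h]
      exact supGrad_mono hv (ball_subset_ball (by nlinarith))
  have hbdd : BddAbove S := by
    have key : ∃ K : ℝ, ∀ x ∈ cube c ℓ,
        Real.log (supGrad v (ball x (10 * n * ℓ)) / supGrad v (ball x ℓ)) ≤ K := by
      obtain ⟨K, hK⟩ := ((cube_compact c ℓ).cthickening (r := 10 * n * ℓ)).exists_bound_of_continuousOn
        (cont_fd hv).continuousOn
      have hMK : ∀ x ∈ cube c ℓ, supGrad v (ball x (10 * n * ℓ)) ≤ max K 0 := by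
        intro x hx
        refine supGrad_le (le_max_right _ _) fun y hy => le_max_of_le_left ?_
        exact hK y (thickening_subset_cthickening _ _ (ball_subset_thickening hx _ hy))
      refine (cube_compact c ℓ).induction_on (p := fun s => ∃ K : ℝ, ∀ x ∈ s,
        Real.log (supGrad v (ball x (10 * n * ℓ)) / supGrad v (ball x ℓ)) ≤ K) ⟨0, by simp⟩
        (fun s t hst ⟨K, hK⟩ => ⟨K, fun x hx => hK x (hst hx)⟩)
        (fun s t ⟨K, hK⟩ ⟨K', hK'⟩ => ⟨max K K', fun x hx => ?_⟩) ?_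
      · rcases hx with hx | hx
        · exact le_max_of_le_left (hK x hx)
        · exact le_max_of_le_right (hK' x hx)
      · intro x hx
        rcases (supGrad_nonneg v (ball x ℓ)).eq_or_lt with h | h
        · refine ⟨ball x ℓ, mem_nhdsWithin_of_mem_nhds (ball_mem_nhds x hℓ), 0, ?_⟩
          intro z hz
          have h2 := zero_prop hv hℓ (hl8 x hx) h.symm
          have h3 : supGrad v (ball z ℓ) = 0 := by
            refine le_antisymm ?_ (supGrad_nonneg _ _)
            rw [← h2]
            refine supGrad_mono hv (ball_subset_ball' ?_)
            rw [mem_ball] at hz; linarith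
          rw [h3]; simp
        · have : ∃ y ∈ ball x ℓ, 0 < ‖fderiv ℝ v y‖ := by
            by_contra! hcon
            exact absurd (supGrad_le le_rfl hcon) (not_le.2 h)
          obtain ⟨y, hy, hypos⟩ := this
          refine ⟨ball y ℓ ∩ cube c ℓ, Filter.inter_mem (mem_nhdsWithin_of_mem_nhds (isOpen_ball.mem_nhds (by rwa [mem_ball_comm])))
            self_mem_nhdsWithin, max (Real.log (max K 0 / ‖fderiv ℝ v y‖)) 0, ?_⟩
          rintro z ⟨hz, hzc⟩
          have h4 : ‖fderiv ℝ v y‖ ≤ supGrad v (ball z ℓ) := le_supGrad hv (by rwa [mem_ball_comm])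
          have h5 : supGrad v (ball z (10 * n * ℓ)) / supGrad v (ball z ℓ) ≤ max K 0 / ‖fderiv ℝ v y‖ :=
            div_le_div₀ (le_max_right _ _) (hMK z hzc) hypos h4
          have h6 : 0 ≤ supGrad v (ball z (10 * n * ℓ)) / supGrad v (ball z ℓ) :=
            div_nonneg (supGrad_nonneg _ _) (supGrad_nonneg _ _)
          rcases h6.eq_or_lt with h7 | h7
          · rw [← h7]; simp
          · exact le_max_of_le_left (Real.log_le_log h7 h5)
    obtain ⟨K, hK⟩ := key
    refine ⟨K, ?_⟩
    rintro t ⟨x, hx, rfl⟩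
    rw [hsup x hx _ le_rfl, hsup x hx ℓ (by nlinarith)]
    exact hK x hx
  have hS0 : 0 ≤ sSup S := Real.sSup_nonneg hSnn
  have hRHS : 0 ≤ (m + 2) * Real.log (6 * 4 ^ n) + (m + 1) * sSup S := by positivity
  refine Real.sSup_le ?_ hRHS
  rintro t ⟨x, hx, r, hr, hrℓ, rfl⟩
  have hle : Real.log (supGrad v (ball x (10 * n * ℓ)) / supGrad v (ball x ℓ)) ≤ sSup S := by
    refine le_csSup hbdd ⟨x, hx, ?_⟩
    rw [hsup x hx _ le_rfl, hsup x hx ℓ (by nlinarith)]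
  rw [hsup x hx (10 * n * r) (by gcongr), hsup x hx r (by nlinarith)]
  rcases (supGrad_nonneg v (ball x r)).eq_or_lt with h | h
  · rw [← h]; simpa using hRHS
  have hpos : 0 < supGrad v (ball x ℓ) := h.trans_le (supGrad_mono hv (ball_subset_ball hrℓ))
  have hpos2 : 0 < supGrad v (ball x (10 * n * r)) :=
    h.trans_le (supGrad_mono hv (ball_subset_ball (by nlinarith)))
  have hpos3 : 0 < supGrad v (ball x (10 * n * ℓ)) :=
    hpos.trans_le (supGrad_mono hv (ball_subset_ball (by nlinarith)))
  have hg := growth hv hn hℓ (hl8 x hx) m hm2 hr hrℓ hpos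
  have hRpos : 0 < supGrad v (ball x (10 * n * ℓ)) / supGrad v (ball x ℓ) := div_pos hpos3 hpos
  have hg' := Real.log_le_log (by positivity) hg
  set R := supGrad v (ball x (10 * n * ℓ)) / supGrad v (ball x ℓ) with hRd
  have hApos : (0 : ℝ) < 6 * 4 ^ n := by positivity
  rw [Real.log_mul (by positivity) (by positivity), Real.log_mul (by positivity) (by positivity),
    Real.log_pow, Real.log_pow, Real.log_pow, Real.log_mul hApos.ne' (by positivity), Real.log_pow] at hg'
  rw [Real.log_div hpos2.ne' h.ne']
  push_cast at hg'
  have hmm : (0 : ℝ) ≤ (m : ℝ) := Nat.cast_nonneg m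
  have h9 : ((m : ℝ) + 1) * Real.log R ≤ (m + 1) * sSup S := by gcongr
  have h10 : 0 ≤ (m : ℝ) * Real.log (6 * 4 ^ n) := by positivity
  nlinarith
end

section
/- There exist constants N₀, C > 0, depending only on the dimension n, with the following property. Let u be harmonic on the ball B(x, 2r) ⊂ ℝⁿ, let 0 < t < 1/2, and suppose the normalized doubling index satisfies N(x, tr) ≥ N for some N > N₀. Then sup_{B(x, tr)} |∇u| ≤ C · t^{N/6} · sup_{B(x, r)} |∇u|. -/
open MeasureTheory Metric Set ENNReal Matrix RealInnerProductSpace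

open Filter Topology

noncomputable def wt {n : ℕ} (y : EuclideanSpace ℝ (Fin n)) : ℝ := max 0 (1 - ‖y‖ ^ 2)

lemma wt_nonneg {n : ℕ} (y : EuclideanSpace ℝ (Fin n)) : 0 ≤ wt y := le_max_left _ _

lemma wt_le_one {n : ℕ} (y : EuclideanSpace ℝ (Fin n)) : wt y ≤ 1 :=
  max_le (by norm_num) (by nlinarith [sq_nonneg ‖y‖])

lemma wt_cont {n : ℕ} : Continuous (wt (n := n)) := by
  unfold wt; fun_prop

lemma wt_zero {n : ℕ} {y : EuclideanSpace ℝ (Fin n)} (h : y ∉ ball (0 : EuclideanSpace ℝ (Fin n)) 1) :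
    wt y = 0 := by
  simp only [mem_ball, dist_zero_right, not_lt] at h
  apply max_eq_left; nlinarith

lemma wt_supp {n : ℕ} : HasCompactSupport (wt (n := n)) := by
  apply HasCompactSupport.intro (isCompact_closedBall (0 : EuclideanSpace ℝ (Fin n)) 1)
  intro y hy
  exact wt_zero (fun h => hy (ball_subset_closedBall h))

lemma wt_int {n : ℕ} {F : EuclideanSpace ℝ (Fin n) → ℝ} (hF : Continuous F) :
    Integrable (fun y => wt y * F y) :=
  (wt_cont.mul hF).integrable_of_hasCompactSupport wt_supp.mul_right

lemma hasDerivAt_possq (s : ℝ) : HasDerivAt (fun s : ℝ => (max 0 s) ^ 2) (2 * max 0 s) s := by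
  rcases lt_trichotomy s 0 with h | h | h
  · rw [max_eq_left h.le, mul_zero]
    apply (hasDerivAt_const s (0 : ℝ)).congr_of_eventuallyEq
    filter_upwards [eventually_lt_nhds h] with a ha
    simp [max_eq_left ha.le]
  · subst h
    rw [max_self, mul_zero, hasDerivAt_iff_isLittleO]
    have h2 : (fun x : ℝ => x ^ 2) =o[𝓝 0] fun x => x := by
      simpa using Asymptotics.isLittleO_pow_id (𝕜 := ℝ) (n := 2) (by norm_num)
    refine Asymptotics.IsBigO.trans_isLittleO (Asymptotics.IsBigO.of_bound 1 ?_) (by simpa using h2)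
    filter_upwards with x
    simp only [max_self, ne_eq, OfNat.ofNat_ne_zero, not_false_eq_true, zero_pow, sub_zero, smul_zero,
      norm_pow, one_mul]
    gcongr
    simp only [Real.norm_eq_abs, abs_of_nonneg (le_max_left 0 x)]
    exact max_le (abs_nonneg _) (le_abs_self _)
  · rw [max_eq_right h.le]
    have : HasDerivAt (fun s : ℝ => s ^ 2) (2 * s) s := by simpa using hasDerivAt_pow 2 s
    apply this.congr_of_eventuallyEq
    filter_upwards [eventually_gt_nhds h] with a ha
    simp [max_eq_right ha.le]

lemma Wt_hasFDerivAt {n : ℕ} (y : EuclideanSpace ℝ (Fin n)) :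
    HasFDerivAt (fun y : EuclideanSpace ℝ (Fin n) => wt y ^ 2)
      ((-4 * wt y) • innerSL ℝ y) y := by
  have h1 : HasFDerivAt (fun y : EuclideanSpace ℝ (Fin n) => 1 - ‖y‖ ^ 2)
      (-(2 • innerSL ℝ y)) y := ((hasStrictFDerivAt_norm_sq y).hasFDerivAt).const_sub 1
  have h2 := (hasDerivAt_possq (1 - ‖y‖ ^ 2)).comp_hasFDerivAt y h1
  refine h2.congr_fderiv ?_
  ext v
  simp [wt]
  ring

/-- second directional derivative -/
noncomputable def d2 {n : ℕ} (f : EuclideanSpace ℝ (Fin n) → ℝ) (a b x : EuclideanSpace ℝ (Fin n)) : ℝ :=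
  fderiv ℝ (fun y => fderiv ℝ f y a) x b

noncomputable def lap {n : ℕ} (f : EuclideanSpace ℝ (Fin n) → ℝ) (x : EuclideanSpace ℝ (Fin n)) : ℝ :=
  ∑ i : Fin n, d2 f (EuclideanSpace.single i 1) (EuclideanSpace.single i 1) x

lemma sm_fd {n : ℕ} {f : EuclideanSpace ℝ (Fin n) → ℝ} (hf : ContDiff ℝ (⊤ : ℕ∞) f)
    (a : EuclideanSpace ℝ (Fin n)) : ContDiff ℝ (⊤ : ℕ∞) (fun y => fderiv ℝ f y a) := by
  have : ContDiff ℝ (⊤ : ℕ∞) (fderiv ℝ f) := hf.fderiv_right (by simp)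
  exact this.clm_apply contDiff_const

lemma sm_diff {n : ℕ} {f : EuclideanSpace ℝ (Fin n) → ℝ} (hf : ContDiff ℝ (⊤ : ℕ∞) f) :
    Differentiable ℝ f := hf.differentiable (by simp)

lemma d2_cont {n : ℕ} {f : EuclideanSpace ℝ (Fin n) → ℝ} (hf : ContDiff ℝ (⊤ : ℕ∞) f)
    (a b : EuclideanSpace ℝ (Fin n)) : Continuous (d2 f a b) :=
  (sm_fd (sm_fd hf a) b).continuous

lemma d2_symm {n : ℕ} {f : EuclideanSpace ℝ (Fin n) → ℝ} (hf : ContDiff ℝ (⊤ : ℕ∞) f)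
    (a b x : EuclideanSpace ℝ (Fin n)) : d2 f a b x = d2 f b a x := by
  have h1 : ContDiff ℝ (⊤ : ℕ∞) (fderiv ℝ f) := hf.fderiv_right (by simp)
  have h2 : DifferentiableAt ℝ (fderiv ℝ f) x := h1.differentiable (by simp) x
  have key : ∀ c, fderiv ℝ (fun y => fderiv ℝ f y c) x = (fderiv ℝ (fderiv ℝ f) x).flip c := by
    intro c
    rw [fderiv_clm_apply h2 (differentiableAt_const c)]
    simp
  have hs : IsSymmSndFDerivAt ℝ f x := (hf.contDiffAt).isSymmSndFDerivAt (by simp; exact WithTop.coe_le_coe.2 le_top)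
  simp only [d2, key, ContinuousLinearMap.flip_apply]
  exact hs b a

lemma fderiv_eq_sum {n : ℕ} (L : EuclideanSpace ℝ (Fin n) →L[ℝ] ℝ) (y : EuclideanSpace ℝ (Fin n)) :
    L y = ∑ i, y i * L (EuclideanSpace.single i 1) := by
  have h := (EuclideanSpace.basisFun (Fin n) ℝ).sum_repr y
  conv_lhs => rw [← h]
  simp

/-- symmetry of the Euler operator on harmonic functions -/
lemma euler_symm {n : ℕ} {f g : EuclideanSpace ℝ (Fin n) → ℝ} (hf : ContDiff ℝ (⊤ : ℕ∞) f)
    (hg : ContDiff ℝ (⊤ : ℕ∞) g) (hf0 : ∀ y ∈ ball (0 : EuclideanSpace ℝ (Fin n)) 1, lap f y = 0)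
    (hg0 : ∀ y ∈ ball (0 : EuclideanSpace ℝ (Fin n)) 1, lap g y = 0) :
    ∫ y, wt y * (fderiv ℝ f y y * g y - f y * fderiv ℝ g y y) = 0 := by
  set e : Fin n → EuclideanSpace ℝ (Fin n) := fun i => EuclideanSpace.single i 1 with he
  set X : Fin n → EuclideanSpace ℝ (Fin n) → ℝ :=
    fun i y => g y * fderiv ℝ f y (e i) - f y * fderiv ℝ g y (e i) with hX
  have hXs : ∀ i, ContDiff ℝ (⊤ : ℕ∞) (X i) := fun i =>
    (hg.mul (sm_fd hf _)).sub (hf.mul (sm_fd hg _))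
  have hXd : ∀ i y, fderiv ℝ (X i) y (e i) = g y * d2 f (e i) (e i) y - f y * d2 g (e i) (e i) y := by
    intro i y
    have h1 := (sm_diff hg y).hasFDerivAt.mul (sm_diff (sm_fd hf (e i)) y).hasFDerivAt
    have h2 := (sm_diff hf y).hasFDerivAt.mul (sm_diff (sm_fd hg (e i)) y).hasFDerivAt
    have h3 : fderiv ℝ (X i) y = _ := (h1.sub h2).fderiv
    rw [h3]
    simp [d2]
    ring
  have hWd : ∀ y : EuclideanSpace ℝ (Fin n), ∀ i, fderiv ℝ (fun y : EuclideanSpace ℝ (Fin n) => wt y ^ 2) y (e i) = -4 * wt y * y i := by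
    intro y i
    rw [(Wt_hasFDerivAt y).fderiv]
    simp [he, PiLp.inner_apply]
  have hWdiff : Differentiable ℝ (fun y : EuclideanSpace ℝ (Fin n) => wt y ^ 2) :=
    fun y => (Wt_hasFDerivAt y).differentiableAt
  have hci : ∀ i : Fin n, Continuous fun y : EuclideanSpace ℝ (Fin n) => y i := fun i => by fun_prop
  have parts : ∀ i, ∫ y, wt y ^ 2 * fderiv ℝ (X i) y (e i) = 4 * ∫ y, wt y * (y i * X i y) := by
    intro i
    rw [integral_mul_fderiv_eq_neg_fderiv_mul_of_integrable]
    · simp only [hWd]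
      rw [← integral_neg, ← integral_const_mul]
      congr 1; ext y; ring
    · simp only [hWd]
      have := wt_int (F := fun y => -4 * y i * X i y)
        ((continuous_const.mul (hci i)).mul (hXs i).continuous)
      convert this using 2; ring
    · have := wt_int (F := fun y => wt y * fderiv ℝ (X i) y (e i))
        (wt_cont.mul (sm_fd (hXs i) _).continuous)
      convert this using 2; ring
    · have := wt_int (F := fun y => wt y * X i y)
        (wt_cont.mul (hXs i).continuous)
      convert this using 2; ring
    · exact fun y _ => hWdiff y
    · exact fun y _ => sm_diff (hXs i) y
  have sum1 : ∑ i, ∫ y, wt y * (y i * X i y) = ∫ y, wt y * (fderiv ℝ f y y * g y - f y * fderiv ℝ g y y) := by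
    rw [← integral_finsetSum]
    · congr 1; ext y
      rw [fderiv_eq_sum (fderiv ℝ f y) y, fderiv_eq_sum (fderiv ℝ g y) y, ← Finset.mul_sum]
      congr 1
      rw [Finset.sum_mul, Finset.mul_sum, ← Finset.sum_sub_distrib]
      apply Finset.sum_congr rfl
      intro i _
      simp only [hX, he]; ring
    · intro i _
      exact wt_int ((hci i).mul (hXs i).continuous)
  have sum2 : ∑ i, ∫ y, wt y ^ 2 * fderiv ℝ (X i) y (e i) = 0 := by
    rw [← integral_finsetSum]
    · rw [← integral_zero (EuclideanSpace ℝ (Fin n)) ℝ (μ := volume)]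
      congr 1; ext y
      by_cases hy : y ∈ ball (0 : EuclideanSpace ℝ (Fin n)) 1
      · simp only [hXd]
        rw [← Finset.mul_sum, Finset.sum_sub_distrib, ← Finset.mul_sum, ← Finset.mul_sum]
        have a := hf0 y hy
        have b := hg0 y hy
        simp only [lap] at a b
        simp only [he]
        rw [a, b]; simp
      · simp [wt_zero hy]
    · intro i _
      have := wt_int (F := fun y => wt y * fderiv ℝ (X i) y (e i))
        (wt_cont.mul (sm_fd (hXs i) _).continuous)
      convert this using 2; ring
  simp only [parts] at sum2
  rw [← Finset.mul_sum, sum1] at sum2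
  linarith

lemma param_deriv {n : ℕ} {F F' : ℝ → EuclideanSpace ℝ (Fin n) → ℝ}
    (hF : Continuous (Function.uncurry F)) (hF' : Continuous (Function.uncurry F'))
    (hd : ∀ s y, HasDerivAt (fun s => F s y) (F' s y) s) (s : ℝ) :
    HasDerivAt (fun s => ∫ y, wt y * F s y) (∫ y, wt y * F' s y) s := by
  have hK : IsCompact (closedBall s 1 ×ˢ closedBall (0 : EuclideanSpace ℝ (Fin n)) 1) :=
    (isCompact_closedBall _ _).prod (isCompact_closedBall _ _)
  obtain ⟨C, hC⟩ := hK.exists_bound_of_continuousOn hF'.continuousOn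
  have c1 : ∀ s, Continuous (F s) := fun s => hF.comp (Continuous.prodMk_right s)
  have c2 : ∀ s, Continuous (F' s) := fun s => hF'.comp (Continuous.prodMk_right s)
  refine (hasDerivAt_integral_of_dominated_loc_of_deriv_le (bound := fun y => wt y * C)
    (F := fun s y => wt y * F s y) (F' := fun s y => wt y * F' s y)
    (closedBall_mem_nhds s one_pos) ?_ (wt_int (c1 s)) ?_ ?_ (wt_int continuous_const) ?_).2
  · exact Eventually.of_forall fun s => (wt_int (c1 s)).aestronglyMeasurable
  · exact (wt_int (c2 s)).aestronglyMeasurable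
  · refine Eventually.of_forall fun y s' hs' => ?_
    by_cases hy : y ∈ ball (0 : EuclideanSpace ℝ (Fin n)) 1
    · rw [norm_mul, Real.norm_of_nonneg (wt_nonneg y)]
      exact mul_le_mul_of_nonneg_left (hC (s', y) ⟨hs', ball_subset_closedBall hy⟩) (wt_nonneg y)
    · simp [wt_zero hy]
  · exact Eventually.of_forall fun y s' _ => (hd s' y).const_mul _

lemma sc_smooth {n : ℕ} {f : EuclideanSpace ℝ (Fin n) → ℝ} (hf : ContDiff ℝ (⊤ : ℕ∞) f)
    (x : EuclideanSpace ℝ (Fin n)) (ρ : ℝ) : ContDiff ℝ (⊤ : ℕ∞) (fun y => f (x + ρ • y)) :=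
  hf.comp (by fun_prop : ContDiff ℝ (⊤ : ℕ∞) (fun y : EuclideanSpace ℝ (Fin n) => x + ρ • y))

lemma sc_fderiv {n : ℕ} {f : EuclideanSpace ℝ (Fin n) → ℝ} (hf : ContDiff ℝ (⊤ : ℕ∞) f)
    (x : EuclideanSpace ℝ (Fin n)) (ρ : ℝ) (y h : EuclideanSpace ℝ (Fin n)) :
    fderiv ℝ (fun y => f (x + ρ • y)) y h = ρ * fderiv ℝ f (x + ρ • y) h := by
  have h1 : HasFDerivAt (fun y : EuclideanSpace ℝ (Fin n) => x + ρ • y)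
      (ρ • ContinuousLinearMap.id ℝ (EuclideanSpace ℝ (Fin n))) y :=
    ((hasFDerivAt_id y).const_smul ρ).const_add x
  have h2 := (sm_diff hf (x + ρ • y)).hasFDerivAt.comp y h1
  have h3 : fderiv ℝ (fun y => f (x + ρ • y)) y = _ := h2.fderiv
  rw [h3]; simp

lemma sc_lap {n : ℕ} {f : EuclideanSpace ℝ (Fin n) → ℝ} (hf : ContDiff ℝ (⊤ : ℕ∞) f)
    (x : EuclideanSpace ℝ (Fin n)) (ρ : ℝ) (y : EuclideanSpace ℝ (Fin n)) :
    lap (fun y => f (x + ρ • y)) y = ρ ^ 2 * lap f (x + ρ • y) := by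
  simp only [lap, Finset.mul_sum]
  apply Finset.sum_congr rfl
  intro i _
  simp only [d2, sc_fderiv hf]
  rw [fderiv_const_mul (sm_diff (sc_smooth (sm_fd hf _) x ρ) y)]
  simp only [_root_.smul_apply, smul_eq_mul, sc_fderiv (sm_fd hf _)]
  ring

lemma sc_harm {n : ℕ} {f : EuclideanSpace ℝ (Fin n) → ℝ} (hf : ContDiff ℝ (⊤ : ℕ∞) f)
    {x : EuclideanSpace ℝ (Fin n)} {r ρ : ℝ} (h0 : ∀ y ∈ ball x r, lap f y = 0) (hρ : 0 < ρ)
    (hr : ρ ≤ r) :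
    ∀ y ∈ ball (0 : EuclideanSpace ℝ (Fin n)) 1, lap (fun y => f (x + ρ • y)) y = 0 := by
  intro y hy
  rw [sc_lap hf, h0, mul_zero]
  simp only [mem_ball, dist_zero_right] at hy
  simp only [mem_ball, dist_eq_norm, add_sub_cancel_left, norm_smul, Real.norm_of_nonneg hρ.le]
  nlinarith

lemma const_of_deriv {f f' : ℝ → ℝ} {a b : ℝ} (hab : a < b) (hf : ∀ s, HasDerivAt f (f' s) s)
    (h0 : ∀ s, a < s → s < b → f' s = 0) : f a = f b := by
  obtain ⟨c, hc, h⟩ := exists_hasDerivAt_eq_slope f f' hab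
    (fun s _ => (hf s).continuousAt.continuousWithinAt) (fun s _ => hf s)
  rw [h0 c hc.1 hc.2] at h
  have : b - a ≠ 0 := by linarith
  field_simp at h
  linarith

lemma sc_deriv {n : ℕ} {f : EuclideanSpace ℝ (Fin n) → ℝ} (hf : ContDiff ℝ (⊤ : ℕ∞) f)
    (x y : EuclideanSpace ℝ (Fin n)) {α : ℝ → ℝ} {α' s : ℝ} (hα : HasDerivAt α α' s) :
    HasDerivAt (fun s => f (x + α s • y)) (α' * fderiv ℝ f (x + α s • y) y) s := by
  have h1 : HasDerivAt (fun s => x + α s • y) (α' • y) s := (hα.smul_const y).const_add x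
  have h2 := (sm_diff hf (x + α s • y)).hasFDerivAt.comp_hasDerivAt s h1
  exact h2.congr_deriv (by simp)

lemma fd_cont {n : ℕ} {f : EuclideanSpace ℝ (Fin n) → ℝ} (hf : ContDiff ℝ (⊤ : ℕ∞) f) :
    Continuous (fderiv ℝ f) := hf.continuous_fderiv (by simp)

lemma lap_const {n : ℕ} (c : ℝ) (y : EuclideanSpace ℝ (Fin n)) : lap (fun _ => c) y = 0 := by
  simp [lap, d2]

lemma mean_value {n : ℕ} {f : EuclideanSpace ℝ (Fin n) → ℝ} (hf : ContDiff ℝ (⊤ : ℕ∞) f)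
    {z : EuclideanSpace ℝ (Fin n)} {ρ : ℝ} (hρ : 0 < ρ) (h0 : ∀ y ∈ ball z ρ, lap f y = 0) :
    f z * ∫ y : EuclideanSpace ℝ (Fin n), wt y = ∫ y, wt y * f (z + ρ • y) := by
  have hc := hf.continuous
  have hc' := fd_cont hf
  have key := const_of_deriv (f := fun s => ∫ y, wt y * f (z + s • y)) hρ
    (param_deriv (F := fun s y => f (z + s • y)) (F' := fun s y => 1 * fderiv ℝ f (z + s • y) y)
      (by simp only [Function.uncurry_def]; fun_prop) (by simp only [Function.uncurry_def]; fun_prop)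
      (fun s y => sc_deriv hf z y (hasDerivAt_id s))) ?_
  · rw [← key, ← integral_const_mul]
    simp [mul_comm]
  · intro s hs hsρ
    have := euler_symm (sc_smooth hf z s) (contDiff_const (c := (1 : ℝ)))
      (sc_harm hf h0 hs hsρ.le) (fun y _ => lap_const 1 y)
    simp only [sc_fderiv hf] at this
    have h2 : s * ∫ y, wt y * (1 * fderiv ℝ f (z + s • y) y) = 0 := by
      rw [← this, ← integral_const_mul]
      congr 1; ext y; simp; ring
    exact (mul_eq_zero.1 h2).resolve_left hs.ne'

lemma three_scale {n : ℕ} {f : EuclideanSpace ℝ (Fin n) → ℝ} (hf : ContDiff ℝ (⊤ : ℕ∞) f)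
    {x : EuclideanSpace ℝ (Fin n)} {ρ r : ℝ} (hρ : 0 < ρ) (hr : 16 * ρ ≤ r)
    (h0 : ∀ y ∈ ball x r, lap f y = 0) :
    ∫ y, wt y * (f (x + ρ • y) * f (x + (16 * ρ) • y)) = ∫ y, wt y * (f (x + (4 * ρ) • y)) ^ 2 := by
  have hc := hf.continuous
  have hc' := fd_cont hf
  set α : ℝ → ℝ := fun s => ρ * Real.exp s with hα
  set β : ℝ → ℝ := fun s => 16 * ρ * Real.exp (-s) with hβ
  have hα' : ∀ s, HasDerivAt α (α s) s := fun s => (Real.hasDerivAt_exp s).const_mul ρ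
  have hβ' : ∀ s, HasDerivAt β (-β s) s := fun s => by
    have := ((Real.hasDerivAt_exp (-s)).comp s (hasDerivAt_neg s)).const_mul (16 * ρ)
    exact this.congr_deriv (by simp only [hβ]; ring)
  have hαc : Continuous α := by fun_prop
  have hβc : Continuous β := by fun_prop
  have hlog : 0 < Real.log 4 := Real.log_pos (by norm_num)
  have key := const_of_deriv (f := fun s => ∫ y, wt y * (f (x + α s • y) * f (x + β s • y))) hlog
    (param_deriv (F := fun s y => f (x + α s • y) * f (x + β s • y))
      (F' := fun s y => (α s * fderiv ℝ f (x + α s • y) y) * f (x + β s • y) +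
        f (x + α s • y) * (-β s * fderiv ℝ f (x + β s • y) y))
      (by simp only [Function.uncurry_def]; fun_prop) (by simp only [Function.uncurry_def]; fun_prop)
      (fun s y => (sc_deriv hf x y (hα' s)).mul (sc_deriv hf x y (hβ' s)))) ?_
  · have a0 : α 0 = ρ := by simp [hα]
    have b0 : β 0 = 16 * ρ := by simp [hβ]
    have a1 : α (Real.log 4) = 4 * ρ := by
      simp only [hα]; rw [Real.exp_log (by norm_num)]; ring
    have b1 : β (Real.log 4) = 4 * ρ := by
      simp only [hβ]; rw [Real.exp_neg, Real.exp_log (by norm_num)]; ring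
    simp only [a0, b0, a1, b1] at key
    rw [key]
    congr 1; ext y; ring
  · intro s hs hs4
    have e1 : 1 < Real.exp s := Real.one_lt_exp_iff.2 hs
    have e2 : Real.exp s < 4 := by rwa [Real.lt_log_iff_exp_lt (by norm_num)] at hs4
    have e3 : Real.exp (-s) < 1 := by simpa using hs
    have := euler_symm (sc_smooth hf x (α s)) (sc_smooth hf x (β s))
      (sc_harm hf h0 (by positivity) (by simp only [hα]; nlinarith))
      (sc_harm hf h0 (by positivity) (by simp only [hβ]; nlinarith))
    simp only [sc_fderiv hf] at this
    rw [← this]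
    congr 1; ext y; ring

lemma wt_integrable {n : ℕ} : Integrable (wt (n := n)) :=
  wt_cont.integrable_of_hasCompactSupport wt_supp

lemma W0_pos (n : ℕ) : 0 < ∫ y : EuclideanSpace ℝ (Fin n), wt y := by
  apply wt_cont.integral_pos_of_hasCompactSupport_nonneg_nonzero wt_supp wt_nonneg (x := 0)
  simp [wt]

lemma sq_le_avg {n : ℕ} {f : EuclideanSpace ℝ (Fin n) → ℝ} (hf : ContDiff ℝ (⊤ : ℕ∞) f)
    {z : EuclideanSpace ℝ (Fin n)} {ρ : ℝ} (hρ : 0 < ρ) (h0 : ∀ y ∈ ball z ρ, lap f y = 0) :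
    f z ^ 2 * ∫ y : EuclideanSpace ℝ (Fin n), wt y ≤ ∫ y, wt y * f (z + ρ • y) ^ 2 := by
  have hc := hf.continuous
  have h1 := mean_value hf hρ h0
  have h2 : 0 ≤ ∫ y, wt y * (f (z + ρ • y) - f z) ^ 2 :=
    integral_nonneg fun y => mul_nonneg (wt_nonneg y) (sq_nonneg _)
  have h3 : ∫ y, wt y * (f (z + ρ • y) - f z) ^ 2 =
      (∫ y, wt y * f (z + ρ • y) ^ 2) - (2 * f z * (∫ y, wt y * f (z + ρ • y)) -
        f z ^ 2 * ∫ y : EuclideanSpace ℝ (Fin n), wt y) := by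
    have i1 : Integrable (fun y => wt y * f (z + ρ • y) ^ 2) := wt_int (by fun_prop)
    have i2 : Integrable (fun y => wt y * f (z + ρ • y)) := wt_int (by fun_prop)
    have i3 : Integrable (fun y => 2 * f z * (wt y * f (z + ρ • y)) - f z ^ 2 * wt y) :=
      (i2.const_mul _).sub (wt_integrable.const_mul _)
    rw [← integral_const_mul, ← integral_const_mul, ← integral_sub (i2.const_mul _) (wt_integrable.const_mul _),
      ← integral_sub i1 i3]
    congr 1; ext y; ring
  rw [h3, ← h1] at h2
  nlinarith

lemma avg_compare {n : ℕ} {f : EuclideanSpace ℝ (Fin n) → ℝ} (hc : Continuous f)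
    {x z : EuclideanSpace ℝ (Fin n)} {ρ : ℝ} (hρ : 0 < ρ) (hz : z ∈ ball x (2 * ρ)) :
    ∫ y, wt y * f (z + ρ • y) ^ 2 ≤
      4 ^ n * (16 / 7) * ∫ y, wt y * f (x + (4 * ρ) • y) ^ 2 := by
  set c : EuclideanSpace ℝ (Fin n) := (4 * ρ)⁻¹ • (z - x) with hcdef
  have hcz : (4 * ρ) • c = z - x := by
    rw [hcdef, smul_smul, mul_inv_cancel₀ (by positivity), one_smul]
  have hcn : ‖c‖ ≤ 1 / 2 := by
    have h1 : ‖z - x‖ < 2 * ρ := by simpa [dist_eq_norm] using hz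
    rw [← hcz, norm_smul, Real.norm_of_nonneg (by positivity)] at h1
    by_contra h
    push Not at h
    nlinarith
  set h : EuclideanSpace ℝ (Fin n) → ℝ :=
    fun y => wt ((4 : ℝ) • (y - c)) * f (x + (4 * ρ) • y) ^ 2 with hh
  have e1 : ∀ y, wt y * f (z + ρ • y) ^ 2 = h (c + (1 / 4 : ℝ) • y) := by
    intro y
    simp only [hh, add_sub_cancel_left, smul_smul, smul_add]
    have : x + ((4 * ρ) • c + (4 * ρ * (1 / 4)) • y) = z + ρ • y := by
      rw [hcz, show 4 * ρ * (1 / 4) = ρ by ring]; abel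
    rw [this]; norm_num
  have e2 : ∫ y, h (c + (1 / 4 : ℝ) • y) = 4 ^ n * ∫ y, h y := by
    have := Measure.integral_comp_smul (volume : Measure (EuclideanSpace ℝ (Fin n))) (fun y => h (c + y)) (1 / 4 : ℝ)
    rw [this, integral_add_left_eq_self (μ := volume) h c]
    simp
  simp only [e1]
  rw [e2, mul_assoc, ← integral_const_mul (16 / 7 : ℝ)]
  refine mul_le_mul_of_nonneg_left ?_ (by positivity : (0 : ℝ) ≤ 4 ^ n)
  have hnn : ∀ y, 0 ≤ h y := fun y => mul_nonneg (wt_nonneg _) (sq_nonneg _)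
  refine integral_mono_of_nonneg (Eventually.of_forall hnn) ?_ (Eventually.of_forall fun y => ?_)
  · exact (wt_int (F := fun y => f (x + (4 * ρ) • y) ^ 2) (by fun_prop)).const_mul _
  · simp only [hh]
    rw [← mul_assoc]
    refine mul_le_mul_of_nonneg_right ?_ (sq_nonneg _)
    by_cases hy : (4 : ℝ) • (y - c) ∈ ball (0 : EuclideanSpace ℝ (Fin n)) 1
    · refine (wt_le_one _).trans ?_
      have h1 : ‖y - c‖ < 1 / 4 := by
        simp only [mem_ball, dist_zero_right, norm_smul] at hy
        norm_num at hy ⊢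
        linarith
      have h2 : ‖y‖ ≤ 3 / 4 := by
        have := norm_add_le (y - c) c
        rw [sub_add_cancel] at this
        linarith
      have h3 : 1 - ‖y‖ ^ 2 ≤ wt y := le_max_right _ _
      nlinarith [norm_nonneg y]
    · rw [wt_zero hy]
      have := wt_nonneg y
      positivity

noncomputable def GG {n : ℕ} (v : Fin n → EuclideanSpace ℝ (Fin n) → ℝ) (x : EuclideanSpace ℝ (Fin n))
    (ρ : ℝ) : ℝ := ∑ i, ∫ y, wt y * (v i (x + ρ • y)) ^ 2

lemma GG_nonneg {n : ℕ} (v : Fin n → EuclideanSpace ℝ (Fin n) → ℝ) (x : EuclideanSpace ℝ (Fin n))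
    (ρ : ℝ) : 0 ≤ GG v x ρ :=
  Finset.sum_nonneg fun _ _ => integral_nonneg fun y => mul_nonneg (wt_nonneg y) (sq_nonneg _)

lemma GG_conv {n : ℕ} {v : Fin n → EuclideanSpace ℝ (Fin n) → ℝ} (hv : ∀ i, ContDiff ℝ (⊤ : ℕ∞) (v i))
    {x : EuclideanSpace ℝ (Fin n)} {ρ r : ℝ} (hρ : 0 < ρ) (hr : 16 * ρ ≤ r)
    (h0 : ∀ i, ∀ y ∈ ball x r, lap (v i) y = 0) :
    GG v x (4 * ρ) ^ 2 ≤ GG v x ρ * GG v x (16 * ρ) := by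
  have hq : ∀ s : ℝ, 0 ≤ GG v x (16 * ρ) * (s * s) + (-2 * GG v x (4 * ρ)) * s + GG v x ρ := by
    intro s
    have : GG v x (16 * ρ) * (s * s) + (-2 * GG v x (4 * ρ)) * s + GG v x ρ =
        ∑ i, ∫ y, wt y * (v i (x + ρ • y) - s * v i (x + (16 * ρ) • y)) ^ 2 := by
      simp only [GG, Finset.mul_sum, Finset.sum_mul, ← Finset.sum_add_distrib]
      apply Finset.sum_congr rfl
      intro i _
      have hc := (hv i).continuous
      have i1 : Integrable (fun y => wt y * v i (x + ρ • y) ^ 2) := wt_int (by fun_prop)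
      have i2 : Integrable (fun y => wt y * v i (x + (16 * ρ) • y) ^ 2) := wt_int (by fun_prop)
      have i3 : Integrable (fun y => wt y * (v i (x + ρ • y) * v i (x + (16 * ρ) • y))) :=
        wt_int (by fun_prop)
      have i4 : Integrable (fun y => wt y * v i (x + (16 * ρ) • y) ^ 2 * (s * s) +
          -2 * (wt y * (v i (x + ρ • y) * v i (x + (16 * ρ) • y))) * s) :=
        (i2.mul_const _).add ((i3.const_mul _).mul_const _)
      rw [← three_scale (hv i) hρ hr (h0 i), ← integral_mul_const, ← integral_const_mul, ← integral_mul_const,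
        ← integral_add (i2.mul_const _) ((i3.const_mul _).mul_const _),
        ← integral_add i4 i1]
      congr 1; ext y; ring
    rw [this]
    exact Finset.sum_nonneg fun _ _ => integral_nonneg fun y => mul_nonneg (wt_nonneg y) (sq_nonneg _)
  have := discrim_le_zero hq
  simp only [discrim] at this
  nlinarith

lemma GG_lower {n : ℕ} {v : Fin n → EuclideanSpace ℝ (Fin n) → ℝ} (hv : ∀ i, ContDiff ℝ (⊤ : ℕ∞) (v i))
    {x z : EuclideanSpace ℝ (Fin n)} {ρ r : ℝ} (hρ : 0 < ρ) (hr : 4 * ρ ≤ r) (hz : z ∈ ball x (2 * ρ))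
    (h0 : ∀ i, ∀ y ∈ ball x r, lap (v i) y = 0) :
    (∑ i, v i z ^ 2) ≤ (4 ^ n * (16 / 7) / ∫ y : EuclideanSpace ℝ (Fin n), wt y) * GG v x (4 * ρ) := by
  have hW := W0_pos n
  rw [div_mul_eq_mul_div, le_div_iff₀ hW, GG, Finset.mul_sum, Finset.sum_mul]
  apply Finset.sum_le_sum
  intro i _
  refine (sq_le_avg (hv i) hρ ?_).trans (avg_compare (hv i).continuous hρ hz)
  intro y hy
  refine h0 i y (ball_subset_ball' ?_ hy)
  have := mem_ball.1 hz
  linarith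

lemma norm_sq_le {n : ℕ} (L : EuclideanSpace ℝ (Fin n) →L[ℝ] ℝ) :
    ‖L‖ ^ 2 ≤ ∑ i, L (EuclideanSpace.single i 1) ^ 2 := by
  have h : ‖L‖ ≤ √(∑ i, L (EuclideanSpace.single i 1) ^ 2) := by
    refine L.opNorm_le_bound (Real.sqrt_nonneg _) fun y => ?_
    rw [EuclideanSpace.norm_eq, ← Real.sqrt_mul (Finset.sum_nonneg fun _ _ => sq_nonneg _)]
    apply Real.abs_le_sqrt
    rw [fderiv_eq_sum L y, mul_comm]
    simpa using Finset.sum_mul_sq_le_sq_mul_sq Finset.univ (fun i => y i) (fun i => L (EuclideanSpace.single i 1))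
  calc ‖L‖ ^ 2 ≤ √(∑ i, L (EuclideanSpace.single i 1) ^ 2) ^ 2 := by gcongr
    _ = _ := Real.sq_sqrt (Finset.sum_nonneg fun _ _ => sq_nonneg _)

lemma sum_sq_le {n : ℕ} (L : EuclideanSpace ℝ (Fin n) →L[ℝ] ℝ) (i : Fin n) :
    L (EuclideanSpace.single i 1) ^ 2 ≤ ‖L‖ ^ 2 := by
  have := L.le_opNorm (EuclideanSpace.single i 1)
  simp only [PiLp.norm_single, norm_one, mul_one] at this
  rw [← sq_abs]
  exact pow_le_pow_left₀ (abs_nonneg _) this 2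

/-- partial derivatives -/
noncomputable def pd {n : ℕ} (u : EuclideanSpace ℝ (Fin n) → ℝ) (i : Fin n) (y : EuclideanSpace ℝ (Fin n)) : ℝ :=
  fderiv ℝ u y (EuclideanSpace.single i 1)

lemma pd_harm {n : ℕ} {u : EuclideanSpace ℝ (Fin n) → ℝ} (hu : ContDiff ℝ (⊤ : ℕ∞) u)
    {x : EuclideanSpace ℝ (Fin n)} {r : ℝ} (h0 : ∀ y ∈ ball x r, lap u y = 0) (i : Fin n) :
    ∀ y ∈ ball x r, lap (pd u i) y = 0 := by
  intro y hy
  have e1 : ∀ j : Fin n, d2 (pd u i) (EuclideanSpace.single j 1) (EuclideanSpace.single j 1) y =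
      fderiv ℝ (d2 u (EuclideanSpace.single j 1) (EuclideanSpace.single j 1)) y (EuclideanSpace.single i 1) := by
    intro j
    have a : (fun z => fderiv ℝ (pd u i) z (EuclideanSpace.single j 1)) =
        fun z => fderiv ℝ (pd u j) z (EuclideanSpace.single i 1) := by
      ext z
      exact d2_symm hu _ _ z
    rw [d2, a]
    exact d2_symm (sm_fd hu _) _ _ y
  rw [lap]
  simp only [e1]
  have e2 : fderiv ℝ (lap u) y = 0 := by
    have : lap u =ᶠ[𝓝 y] fun _ => (0 : ℝ) := by
      filter_upwards [isOpen_ball.mem_nhds hy] with z hz using h0 z hz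
    rw [this.fderiv_eq]; simp
  have e3 : fderiv ℝ (lap u) y = ∑ j, fderiv ℝ (d2 u (EuclideanSpace.single j 1) (EuclideanSpace.single j 1)) y := by
    have := fderiv_fun_sum (𝕜 := ℝ) (u := Finset.univ) (x := y)
      (A := fun j : Fin n => d2 u (EuclideanSpace.single j 1) (EuclideanSpace.single j 1))
      (fun j _ => sm_diff (sm_fd (sm_fd hu _) _) y)
    exact this
  have e4 := congrArg (fun L => L (EuclideanSpace.single i 1)) (e3.symm.trans e2)
  simpa using e4

lemma sg_bdd {n : ℕ} {u : EuclideanSpace ℝ (Fin n) → ℝ} (hu : ContDiff ℝ (⊤ : ℕ∞) u)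
    (x : EuclideanSpace ℝ (Fin n)) (s : ℝ) : BddAbove ((fun x => ‖fderiv ℝ u x‖) '' ball x s) := by
  have hc : Continuous (fun x => ‖fderiv ℝ u x‖) := (fd_cont hu).norm
  exact ((isCompact_closedBall x s).image hc).bddAbove.mono (image_mono ball_subset_closedBall)

lemma le_sg {n : ℕ} {u : EuclideanSpace ℝ (Fin n) → ℝ} (hu : ContDiff ℝ (⊤ : ℕ∞) u)
    {x z : EuclideanSpace ℝ (Fin n)} {s : ℝ} (hz : z ∈ ball x s) : ‖fderiv ℝ u z‖ ≤ supGrad u (ball x s) :=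
  le_csSup (sg_bdd hu x s) ⟨z, hz, rfl⟩

lemma sg_nonneg {n : ℕ} (u : EuclideanSpace ℝ (Fin n) → ℝ) (s : Set (EuclideanSpace ℝ (Fin n))) :
    0 ≤ supGrad u s := by
  apply Real.sSup_nonneg
  rintro _ ⟨z, _, rfl⟩
  exact norm_nonneg _

lemma sg_le {n : ℕ} {u : EuclideanSpace ℝ (Fin n) → ℝ} {s : Set (EuclideanSpace ℝ (Fin n))} {B : ℝ}
    (hB : 0 ≤ B) (h : ∀ z ∈ s, ‖fderiv ℝ u z‖ ≤ B) : supGrad u s ≤ B := by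
  apply Real.sSup_le _ hB
  rintro _ ⟨z, hz, rfl⟩
  exact h z hz

lemma sg_mono {n : ℕ} {u : EuclideanSpace ℝ (Fin n) → ℝ} (hu : ContDiff ℝ (⊤ : ℕ∞) u)
    (x : EuclideanSpace ℝ (Fin n)) {s s' : ℝ} (h : s ≤ s') :
    supGrad u (ball x s) ≤ supGrad u (ball x s') :=
  sg_le (sg_nonneg _ _) fun _ hz => le_sg hu (ball_subset_ball h hz)

lemma GG_upper {n : ℕ} {u : EuclideanSpace ℝ (Fin n) → ℝ} (hu : ContDiff ℝ (⊤ : ℕ∞) u)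
    (x : EuclideanSpace ℝ (Fin n)) {ρ : ℝ} (hρ : 0 < ρ) :
    GG (pd u) x ρ ≤ ((n + 1) * ∫ y : EuclideanSpace ℝ (Fin n), wt y) * supGrad u (ball x ρ) ^ 2 := by
  set W0 := ∫ y : EuclideanSpace ℝ (Fin n), wt y with hW0
  have hW : 0 < W0 := W0_pos n
  have h1 : ∀ i, ∫ y, wt y * (pd u i (x + ρ • y)) ^ 2 ≤ W0 * supGrad u (ball x ρ) ^ 2 := by
    intro i
    rw [hW0, ← integral_mul_const]
    have hnn : ∀ y, 0 ≤ wt y * (pd u i (x + ρ • y)) ^ 2 := fun y => mul_nonneg (wt_nonneg _) (sq_nonneg _)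
    refine integral_mono_of_nonneg (Eventually.of_forall hnn) (wt_integrable.mul_const _)
      (Eventually.of_forall fun y => ?_)
    by_cases hy : y ∈ ball (0 : EuclideanSpace ℝ (Fin n)) 1
    · refine mul_le_mul_of_nonneg_left ((sum_sq_le _ i).trans ?_) (wt_nonneg y)
      refine pow_le_pow_left₀ (norm_nonneg _) (le_sg hu ?_) 2
      simp only [mem_ball, dist_zero_right] at hy
      simp only [mem_ball, dist_eq_norm, add_sub_cancel_left, norm_smul, Real.norm_of_nonneg hρ.le]
      nlinarith
    · simp [wt_zero hy]
  calc GG (pd u) x ρ ≤ ∑ _i : Fin n, W0 * supGrad u (ball x ρ) ^ 2 := Finset.sum_le_sum fun i _ => h1 i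
    _ = n * (W0 * supGrad u (ball x ρ) ^ 2) := by simp
    _ ≤ _ := by nlinarith [mul_nonneg hW.le (sq_nonneg (supGrad u (ball x ρ)))]

lemma sg_lower {n : ℕ} {u : EuclideanSpace ℝ (Fin n) → ℝ} (hu : ContDiff ℝ (⊤ : ℕ∞) u)
    {x : EuclideanSpace ℝ (Fin n)} {ρ r : ℝ} (hρ : 0 < ρ) (hr : 4 * ρ ≤ r)
    (h0 : ∀ y ∈ ball x r, lap u y = 0) :
    supGrad u (ball x (2 * ρ)) ^ 2 ≤
      (4 ^ n * (16 / 7) / ∫ y : EuclideanSpace ℝ (Fin n), wt y) * GG (pd u) x (4 * ρ) := by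
  have hW := W0_pos n
  have hnn : 0 ≤ (4 ^ n * (16 / 7) / ∫ y : EuclideanSpace ℝ (Fin n), wt y) * GG (pd u) x (4 * ρ) :=
    mul_nonneg (by positivity) (GG_nonneg _ _ _)
  rw [← Real.sq_sqrt hnn]
  refine pow_le_pow_left₀ (sg_nonneg _ _) (sg_le (Real.sqrt_nonneg _) fun z hz => ?_) 2
  apply Real.le_sqrt_of_sq_le
  exact (norm_sq_le _).trans (GG_lower (fun i => sm_fd hu _) hρ hr hz (pd_harm hu h0))

lemma chain {G : ℕ → ℝ} {J : ℕ} {K : ℝ} (hG : ∀ j, 0 ≤ G j) (hK : 0 < K) (h1 : 0 < G 1)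
    (h01 : K * G 0 ≤ G 1) (hc : ∀ j, j + 2 ≤ J → G (j + 1) ^ 2 ≤ G j * G (j + 2)) :
    ∀ j, j + 1 ≤ J → K * G j ≤ G (j + 1) ∧ 0 < G (j + 1) ∧ K ^ j * G 1 ≤ G (j + 1) := by
  intro j
  induction j with
  | zero => intro _; exact ⟨h01, h1, by simp⟩
  | succ j ih =>
    intro hj
    obtain ⟨a, b, c⟩ := ih (by omega)
    have d := hc j (by omega)
    have hj0 : 0 < G j := by
      rcases (hG j).lt_or_eq with h | h
      · exact h
      · rw [← h] at d; nlinarith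
    have e : K * G (j + 1) ≤ G (j + 1 + 1) := by
      refine le_of_mul_le_mul_left ?_ hj0
      nlinarith [mul_le_mul_of_nonneg_right a b.le]
    refine ⟨e, lt_of_lt_of_le (by positivity) e, ?_⟩
    calc K ^ (j + 1) * G 1 = K * (K ^ j * G 1) := by ring
      _ ≤ K * G (j + 1) := by gcongr
      _ ≤ _ := e

lemma core (n : ℕ) :
    ∃ N₀ : ℝ, 0 < N₀ ∧
      ∀ (u : EuclideanSpace ℝ (Fin n) → ℝ) (x : EuclideanSpace ℝ (Fin n)) (r t N : ℝ),
        0 < r → 0 < t → t < 1 / 2 → ContDiff ℝ (⊤ : ℕ∞) u → (∀ y ∈ ball x r, lap u y = 0) →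
        N₀ < N → N ≤ doublingIndex u x (t * r) →
        supGrad u (ball x (t * r)) ≤ t ^ (N / 6) * supGrad u (ball x r) := by
  set C1 : ℝ := 4 ^ n * (16 / 7) / ∫ y : EuclideanSpace ℝ (Fin n), wt y with hC1
  set C2 : ℝ := (n + 1) * ∫ y : EuclideanSpace ℝ (Fin n), wt y with hC2
  have hW := W0_pos n
  have p1 : 0 < C1 := by positivity
  have p2 : 0 < C2 := by positivity
  refine ⟨|Real.log (C1 * C2)| + 1, by positivity, ?_⟩
  intro u x r t N hr ht ht2 hu h0 hN hd
  have hNl : Real.log (C1 * C2) ≤ N := by linarith [le_abs_self (Real.log (C1 * C2))]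
  have hNp : 0 < N := by linarith [abs_nonneg (Real.log (C1 * C2))]
  set m := supGrad u (ball x (t * r)) with hm
  set m2 := supGrad u (ball x (2 * (t * r))) with hm2
  have hm0 : 0 ≤ m := sg_nonneg _ _
  have hm20 : 0 ≤ m2 := sg_nonneg _ _
  have hd' : N ≤ Real.log (m2 / m) := hd
  have hq : 0 < m2 / m := by
    rcases (div_nonneg hm20 hm0).lt_or_eq with h | h
    · exact h
    · rw [← h, Real.log_zero] at hd'; linarith
  have hmp : 0 < m := by
    rcases hm0.lt_or_eq with h | h
    · exact h
    · rw [← h] at hq; simp at hq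
  have hexp : Real.exp N * m ≤ m2 := by
    rw [Real.le_log_iff_exp_le hq, le_div_iff₀ hmp] at hd'
    exact hd'
  have htr : 0 < t * r := by positivity
  have hm2r : m2 ≤ supGrad u (ball x r) := sg_mono hu x (by nlinarith)
  -- reduction
  suffices hs : ∃ a : ℝ, -Real.log t / 6 ≤ a ∧ Real.exp (N * a) * m ≤ supGrad u (ball x r) by
    obtain ⟨a, ha, h⟩ := hs
    have e1 : Real.exp (-(N * a)) ≤ t ^ (N / 6) := by
      rw [Real.rpow_def_of_pos ht]
      apply Real.exp_le_exp.2
      nlinarith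
    calc m = Real.exp (-(N * a)) * (Real.exp (N * a) * m) := by
          rw [← mul_assoc, ← Real.exp_add]; simp
      _ ≤ Real.exp (-(N * a)) * supGrad u (ball x r) := by gcongr
      _ ≤ _ := by
          have := sg_nonneg u (ball x r)
          gcongr
  obtain ⟨J, hJ1, hJ2⟩ := exists_nat_pow_near (x := 1 / t) (y := (4 : ℝ))
    (by rw [le_div_iff₀ ht]; linarith) (by norm_num)
  have hlog : -Real.log t ≤ (J + 1) * (3 / 2) := by
    have h1 := Real.log_lt_log (by positivity) hJ2
    rw [Real.log_pow, Real.log_div one_ne_zero ht.ne', Real.log_one] at h1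
    have h2 : Real.log 4 ≤ 3 / 2 := by
      rw [show (4 : ℝ) = 2 ^ 2 by norm_num, Real.log_pow]
      have := Real.log_two_lt_d9
      push_cast
      linarith
    push_cast at h1
    nlinarith
  rcases Nat.eq_zero_or_pos J with hJ | hJ
  · subst hJ
    refine ⟨1, by push_cast at hlog; linarith, ?_⟩
    rw [mul_one]
    exact hexp.trans hm2r
  · obtain ⟨k, rfl⟩ : ∃ k, J = k + 1 := ⟨J - 1, by omega⟩
    refine ⟨(k + 1) / 2, by push_cast at hlog; linarith [(Nat.cast_nonneg k : (0 : ℝ) ≤ k)], ?_⟩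
    have hJ1' : (4 : ℝ) ^ (k + 1) * t ≤ 1 := by rwa [le_div_iff₀ ht] at hJ1
    set G : ℕ → ℝ := fun j => GG (pd u) x (4 ^ j * (t * r)) with hG
    have hscale : ∀ j, j ≤ k + 1 → (4 : ℝ) ^ j * (t * r) ≤ r := by
      intro j hj
      have : (4 : ℝ) ^ j ≤ 4 ^ (k + 1) := pow_le_pow_right₀ (by norm_num) hj
      calc (4 : ℝ) ^ j * (t * r) ≤ 4 ^ (k + 1) * (t * r) := by gcongr
        _ = 4 ^ (k + 1) * t * r := by ring
        _ ≤ 1 * r := by gcongr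
        _ = r := one_mul r
    have g1 : m2 ^ 2 ≤ C1 * G 1 := by
      have := sg_lower hu htr (by simpa using hscale 1 (by omega)) h0
      simpa [hG] using this
    have g0 : G 0 ≤ C2 * m ^ 2 := by
      simpa [hG] using GG_upper hu x htr
    have hm2p : Real.exp N ^ 2 * m ^ 2 ≤ m2 ^ 2 := by
      rw [← mul_pow]; exact pow_le_pow_left₀ (by positivity) hexp 2
    set K := Real.exp N ^ 2 / (C1 * C2) with hK
    have hKp : 0 < K := by positivity
    have hKN : Real.exp N ≤ K := by
      rw [hK, le_div_iff₀ (by positivity), sq]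
      refine mul_le_mul_of_nonneg_left ?_ (Real.exp_pos _).le
      rwa [Real.log_le_iff_le_exp (by positivity)] at hNl
    have hKm : K * C2 * m ^ 2 ≤ G 1 := by
      have : K * C2 * m ^ 2 = Real.exp N ^ 2 * m ^ 2 / C1 := by
        rw [hK]; field_simp
      rw [this, div_le_iff₀ p1]
      linarith
    have hc := chain (G := G) (J := k + 1) (K := K) (fun j => GG_nonneg _ _ _) hKp
      (lt_of_lt_of_le (by positivity) hKm)
      (by
        refine le_trans ?_ hKm
        rw [mul_assoc]; gcongr)
      (by
        intro j hj
        have := GG_conv (v := pd u) (fun i => sm_fd hu _) (ρ := 4 ^ j * (t * r)) (by positivity)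
          (by have := hscale (j + 2) hj; rw [pow_add] at this; linarith) (pd_harm hu h0)
        simp only [hG]
        rw [show (4 : ℝ) ^ (j + 1) * (t * r) = 4 * (4 ^ j * (t * r)) by ring,
          show (4 : ℝ) ^ (j + 2) * (t * r) = 16 * (4 ^ j * (t * r)) by ring]
        exact this) k le_rfl
    have hup : G (k + 1) ≤ C2 * supGrad u (ball x r) ^ 2 := by
      refine (GG_upper hu x (by positivity)).trans ?_
      refine mul_le_mul_of_nonneg_left ?_ p2.le
      exact pow_le_pow_left₀ (sg_nonneg _ _) (sg_mono hu x (hscale _ le_rfl)) 2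
    have f1 : C2 * (K ^ (k + 1) * m ^ 2) ≤ C2 * supGrad u (ball x r) ^ 2 := by
      calc C2 * (K ^ (k + 1) * m ^ 2) = K ^ k * (K * C2 * m ^ 2) := by ring
        _ ≤ K ^ k * G 1 := by gcongr
        _ ≤ G (k + 1) := hc.2.2
        _ ≤ _ := hup
    have f2 := le_of_mul_le_mul_left f1 p2
    refine le_of_sq_le_sq ?_ (sg_nonneg _ _)
    refine le_trans ?_ f2
    rw [mul_pow]
    refine mul_le_mul_of_nonneg_right ?_ (sq_nonneg _)
    calc Real.exp (N * ((k + 1) / 2)) ^ 2 = Real.exp N ^ (k + 1) := by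
          rw [← Real.exp_nat_mul, ← Real.exp_nat_mul]; congr 1; push_cast; ring
      _ ≤ K ^ (k + 1) := by gcongr

lemma extend {n : ℕ} {u : EuclideanSpace ℝ (Fin n) → ℝ} {x : EuclideanSpace ℝ (Fin n)} {r : ℝ}
    (hr : 0 < r) (hu : IsHarmonicOn u (ball x (2 * r))) :
    ∃ v : EuclideanSpace ℝ (Fin n) → ℝ, ContDiff ℝ (⊤ : ℕ∞) v ∧ (∀ y ∈ ball x r, lap v y = 0) ∧
      ∀ y ∈ ball x r, fderiv ℝ v y = fderiv ℝ u y := by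
  let χ : ContDiffBump x := ⟨r, 3 / 2 * r, hr, by linarith⟩
  have hev : ∀ y ∈ ball x r, (fun z => χ z * u z) =ᶠ[𝓝 y] u := by
    intro y hy
    filter_upwards [isOpen_ball.mem_nhds hy] with z hz
    rw [χ.one_of_mem_closedBall (ball_subset_closedBall hz), one_mul]
  refine ⟨fun z => χ z * u z, ?_, ?_, ?_⟩
  · rw [contDiff_iff_contDiffAt]
    intro y
    by_cases hy : y ∈ ball x (2 * r)
    · exact χ.contDiff.contDiffAt.mul (hu.1.contDiffAt (isOpen_ball.mem_nhds hy))
    · have : (fun z => χ z * u z) =ᶠ[𝓝 y] fun _ => 0 := by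
        have hy' : y ∈ (closedBall x (3 / 2 * r))ᶜ := by
          simp only [mem_ball, not_lt] at hy
          simp only [mem_compl_iff, mem_closedBall, not_le]
          linarith
        filter_upwards [isClosed_closedBall.isOpen_compl.mem_nhds hy'] with z hz
        have : χ z = 0 := by
          apply χ.zero_of_le_dist
          simp only [mem_compl_iff, mem_closedBall, not_le] at hz
          exact hz.le
        simp [this]
      exact contDiffAt_const.congr_of_eventuallyEq this
  · intro y hy
    have h := hu.2 y (ball_subset_ball (by linarith) hy)
    rw [← h, lap]
    apply Finset.sum_congr rfl
    intro i _
    rw [d2]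
    congr 1
    apply Filter.EventuallyEq.fderiv_eq
    filter_upwards [isOpen_ball.mem_nhds hy] with z hz
    rw [(hev z hz).fderiv_eq]
  · intro y hy
    exact (hev y hy).fderiv_eq

lemma sg_congr {n : ℕ} {u v : EuclideanSpace ℝ (Fin n) → ℝ} {s : Set (EuclideanSpace ℝ (Fin n))}
    (h : ∀ y ∈ s, fderiv ℝ v y = fderiv ℝ u y) : supGrad v s = supGrad u s := by
  unfold supGrad
  congr 1
  apply image_congr
  intro y hy
  rw [h y hy]

/-- **Doubling at large scales:** there are dimensional constants `N₀, C > 0` such that if `u`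
is harmonic on `B(x,2r)`, `0 < t < 1/2` and `N(x,tr) ≥ N` for some `N > N₀`, then
`sup_{B(x,tr)} |∇u| ≤ C t^{N/6} sup_{B(x,r)} |∇u|`. -/
theorem big_scale_doubling (n : ℕ) :
    ∃ N₀ C : ℝ, 0 < N₀ ∧ 0 < C ∧
      ∀ (u : EuclideanSpace ℝ (Fin n) → ℝ) (x : EuclideanSpace ℝ (Fin n)) (r t N : ℝ),
        0 < r → 0 < t → t < 1 / 2 →
        IsHarmonicOn u (ball x (2 * r)) →
        N₀ < N → N ≤ doublingIndex u x (t * r) →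
        supGrad u (ball x (t * r)) ≤ C * t ^ (N / 6) * supGrad u (ball x r) := by
  obtain ⟨N₀, hN₀, H⟩ := core n
  refine ⟨N₀, 1, hN₀, one_pos, ?_⟩
  intro u x r t N hr ht ht2 hu hN hd
  obtain ⟨v, hv, hv0, hvu⟩ := extend hr hu
  have e1 : supGrad v (ball x r) = supGrad u (ball x r) := sg_congr hvu
  have e2 : supGrad v (ball x (t * r)) = supGrad u (ball x (t * r)) :=
    sg_congr fun y hy => hvu y (ball_subset_ball (by nlinarith) hy)
  have e3 : supGrad v (ball x (2 * (t * r))) = supGrad u (ball x (2 * (t * r))) :=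
    sg_congr fun y hy => hvu y (ball_subset_ball (by nlinarith) hy)
  have := H v x r t N hr ht ht2 hv hv0 hN (by rwa [doublingIndex, e2, e3])
  rwa [e1, e2, ← one_mul (t ^ (N / 6))] at this
end
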